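/- arXiv:1210.7084 — 3 statements merged into one kernel-verified Lean document; each statement's English description precedes it below -/
import Mathlib

section
/- Let M ≥ 1, λ > 0, a ∈ ℝ, and x = (x₁,x₂,x₃) ∈ ℝ³. Then the half-space potential of the generating function η_{2M} in dimension n = 3 satisfies ∫_{y₃ ≥ a} (e^{−λ|x−y|}/(4π|x−y|)) · η_{2M}(y) dy = (1/(8π^{3/2})) ∫₀^∞ e^{−λ²t/4} e^{−|x|²/(1+t)} [ erfc(F(t,x₃,a)) 𝒫_M(x,t) + π^{−1/2} e^{−F(t,x₃,a)²} 𝒬_M(x,t,a) ] dt. -/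
open MeasureTheory Real Finset

/-- Generalized Laguerre polynomial `L_k^{(γ)}(y)`. -/
noncomputable def lag (k : ℕ) (γ : ℝ) (y : ℝ) : ℝ :=
  ∑ i ∈ Finset.range (k + 1),
    (-1 : ℝ) ^ i * (Real.Gamma ((k : ℝ) + γ + 1) /
      (Real.Gamma ((i : ℝ) + γ + 1) * ((k - i).factorial : ℝ))) * y ^ i / (i.factorial : ℝ)

/-- Physicists' Hermite polynomial `H_k(x)`. -/
noncomputable def herm (k : ℕ) (x : ℝ) : ℝ :=
  (-1 : ℝ) ^ k * Real.exp (x ^ 2) * iteratedDeriv k (fun y => Real.exp (-y ^ 2)) x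

/-- Complementary error function. -/
noncomputable def erfc (z : ℝ) : ℝ :=
  (2 / Real.sqrt Real.pi) * ∫ s in Set.Ioi z, Real.exp (-s ^ 2)

/-- The function `F(t,x,a) = √((1+t)/t)·(a − x/(1+t))`. -/
noncomputable def Fn (t x a : ℝ) : ℝ :=
  Real.sqrt ((1 + t) / t) * (a - x / (1 + t))

/-- The generating function `η_{2M}` on `ℝⁿ`. -/
noncomputable def eta (n M : ℕ) (x : EuclideanSpace ℝ (Fin n)) : ℝ :=
  Real.pi ^ (-(n : ℝ) / 2) * lag (M - 1) ((n : ℝ) / 2) (‖x‖ ^ 2) * Real.exp (-‖x‖ ^ 2)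

/-- `𝒫_M(x,t)` in dimension `n`, as a function of `s2 = |x|²`. -/
noncomputable def calP (n M : ℕ) (s2 t : ℝ) : ℝ :=
  ∑ k ∈ Finset.range M,
    (1 + t) ^ (-(k : ℝ) - (n : ℝ) / 2) * lag k ((n : ℝ) / 2 - 1) (s2 / (1 + t))

/-- `𝒬_M(x,t,a)` in dimension `n`, as a function of `r2 = |x'|²` and `xn`. -/
noncomputable def calQ (n M : ℕ) (r2 xn t a : ℝ) : ℝ :=
  2 * (1 + t) ^ (-((n : ℝ) - 1) / 2) *
    ∑ k ∈ Finset.range M, ∑ l ∈ Finset.range (k + 1),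
      ((-1 : ℝ) ^ (k - l) / (((k - l).factorial : ℝ) * (4 : ℝ) ^ (k - l))) *
        lag l (((n : ℝ) - 3) / 2) (r2 / (1 + t)) *
        ∑ j ∈ Finset.Icc 1 (2 * (k - l)),
          ((-1 : ℝ) ^ j / t ^ ((j : ℝ) / 2)) *
            (((2 * (k - l)).choose j : ℝ) * herm (2 * (k - l) - j) (xn / Real.sqrt (1 + t)) *
                herm (j - 1) (Fn t xn a) / (1 + t) ^ ((k : ℝ) + 1 / 2)
              - herm (j - 1) ((a - xn) / Real.sqrt t) * herm (2 * (k - l) - j) a /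
                  (1 + t) ^ (l : ℝ))

/-- `Γ(A+r)/(Γ(A) r!)` is the multichoose coefficient. -/
lemma Gamma_div_eq_multichoose {A : ℝ} (hA : 0 < A) (r : ℕ) :
    Real.Gamma (A + r) / (Real.Gamma A * (r.factorial : ℝ)) = Ring.multichoose A r := by
  have h1 : Real.Gamma (A + r) = (ascPochhammer ℝ r).eval A * Real.Gamma A := by
    induction r with
    | zero => simp
    | succ r ih =>
      rw [ascPochhammer_succ_eval, Nat.cast_succ, ← add_assoc,
        Real.Gamma_add_one (by positivity), ih]
      ring
  have h2 := Ring.factorial_nsmul_multichoose_eq_ascPochhammer A r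
  rw [Polynomial.ascPochhammer_smeval_eq_eval, nsmul_eq_mul] at h2
  have := (Real.Gamma_pos_of_pos hA).ne'
  rw [h1, ← h2]
  field_simp

/-- Chu-Vandermonde identity for multichoose coefficients. -/
lemma multichoose_add_eq_sum (A B : ℝ) (k : ℕ) :
    Ring.multichoose (A + B) k =
      ∑ p ∈ antidiagonal k, Ring.multichoose A p.1 * Ring.multichoose B p.2 := by
  have key : ∀ (C : ℝ) (n : ℕ), Ring.multichoose C n = (-1) ^ n * Ring.choose (-C) n := by
    intro C n
    rw [Ring.choose_neg', Int.negOnePow_def, Units.smul_def]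
    simp [← mul_assoc, ← mul_pow]
  rw [key, neg_add, Ring.add_choose_eq k (Commute.all _ _), mul_sum]
  refine sum_congr rfl fun p hp => ?_
  rw [key A, key B, ← HasAntidiagonal.mem_antidiagonal.mp hp]
  ring

lemma lag_eq_sum_antidiagonal {γ : ℝ} (hγ : -1 < γ) (k : ℕ) (y : ℝ) :
    lag k γ y = ∑ p ∈ antidiagonal k,
      (-y) ^ p.1 / (p.1.factorial : ℝ) * Ring.multichoose ((p.1 : ℝ) + γ + 1) p.2 := by
  rw [lag, Finset.Nat.sum_antidiagonal_eq_sum_range_succ_mk]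
  refine sum_congr rfl fun i hi => ?_
  have hik : i ≤ k := Nat.lt_succ_iff.mp (mem_range.mp hi)
  have : (k : ℝ) + γ + 1 = ((i : ℝ) + γ + 1) + ((k - i : ℕ) : ℝ) := by
    rw [Nat.cast_sub hik]; ring
  have hi0 : (0 : ℝ) ≤ i := i.cast_nonneg
  rw [this, Gamma_div_eq_multichoose (by linarith)]
  rw [neg_pow]
  ring

lemma add_pow_div_factorial (x y : ℝ) (n : ℕ) :
    (x + y) ^ n / (n.factorial : ℝ) =
      ∑ p ∈ antidiagonal n, x ^ p.1 / (p.1.factorial : ℝ) * (y ^ p.2 / (p.2.factorial : ℝ)) := by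
  rw [(Commute.all x y).add_pow', sum_div]
  refine sum_congr rfl fun p hp => ?_
  obtain ⟨i, j⟩ := p
  simp only [HasAntidiagonal.mem_antidiagonal] at hp
  subst hp
  have h := Nat.add_choose_mul_factorial_mul_factorial i j
  have h' : (((i + j).choose i : ℕ) : ℝ) * i.factorial * j.factorial = (i + j).factorial := by
    rw [Nat.choose_symm_add]
    exact_mod_cast h
  simp only [nsmul_eq_mul]
  rw [← h']
  have : (((i + j).choose i : ℕ) : ℝ) ≠ 0 := by
    exact_mod_cast (Nat.choose_pos (Nat.le_add_right i j)).ne'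
  field_simp

/-- Addition formula for Laguerre polynomials. -/
lemma lag_add {α β : ℝ} (hα : -1 < α) (hβ : -1 < β) (k : ℕ) (x y : ℝ) :
    lag k (α + β + 1) (x + y) = ∑ p ∈ antidiagonal k, lag p.1 α x * lag p.2 β y := by
  rw [lag_eq_sum_antidiagonal (by linarith)]
  have hL : ∀ p ∈ antidiagonal k, (-(x + y)) ^ p.1 / (p.1.factorial : ℝ) *
      Ring.multichoose ((p.1 : ℝ) + (α + β + 1) + 1) p.2 =
      ∑ q ∈ antidiagonal p.1, ∑ r ∈ antidiagonal p.2,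
        ((-x) ^ q.1 / (q.1.factorial : ℝ) * Ring.multichoose ((q.1 : ℝ) + α + 1) r.1) *
        ((-y) ^ q.2 / (q.2.factorial : ℝ) * Ring.multichoose ((q.2 : ℝ) + β + 1) r.2) := by
    intro p _
    rw [neg_add, add_pow_div_factorial, sum_mul]
    refine sum_congr rfl fun q hq => ?_
    have : (p.1 : ℝ) + (α + β + 1) + 1 = ((q.1 : ℝ) + α + 1) + ((q.2 : ℝ) + β + 1) := by
      rw [← HasAntidiagonal.mem_antidiagonal.mp hq]; push_cast; ring
    rw [this, multichoose_add_eq_sum, mul_sum]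
    exact sum_congr rfl fun r _ => by ring
  have hR : ∀ p ∈ antidiagonal k, lag p.1 α x * lag p.2 β y =
      ∑ q ∈ antidiagonal p.1, ∑ r ∈ antidiagonal p.2,
        ((-x) ^ q.1 / (q.1.factorial : ℝ) * Ring.multichoose ((q.1 : ℝ) + α + 1) q.2) *
        ((-y) ^ r.1 / (r.1.factorial : ℝ) * Ring.multichoose ((r.1 : ℝ) + β + 1) r.2) := by
    intro p _
    rw [lag_eq_sum_antidiagonal hα, lag_eq_sum_antidiagonal hβ, sum_mul_sum]
  rw [sum_congr rfl hL, sum_congr rfl hR]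
  simp_rw [← sum_product', sum_sigma']
  refine sum_nbij' (fun s => ⟨(s.2.1.1 + s.2.2.1, s.2.1.2 + s.2.2.2),
      ((s.2.1.1, s.2.2.1), (s.2.1.2, s.2.2.2))⟩)
    (fun s => ⟨(s.2.1.1 + s.2.2.1, s.2.1.2 + s.2.2.2),
      ((s.2.1.1, s.2.2.1), (s.2.1.2, s.2.2.2))⟩) ?_ ?_ ?_ ?_ ?_
  · rintro ⟨⟨i, j⟩, ⟨p, q⟩, ⟨r, s⟩⟩ h
    simp only [mem_sigma, mem_product, HasAntidiagonal.mem_antidiagonal] at h ⊢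
    exact ⟨by omega, trivial, trivial⟩
  · rintro ⟨⟨i, j⟩, ⟨p, q⟩, ⟨r, s⟩⟩ h
    simp only [mem_sigma, mem_product, HasAntidiagonal.mem_antidiagonal] at h ⊢
    exact ⟨by omega, trivial, trivial⟩
  · rintro ⟨⟨i, j⟩, ⟨p, q⟩, ⟨r, s⟩⟩ h
    simp only [mem_sigma, mem_product, HasAntidiagonal.mem_antidiagonal] at h
    obtain ⟨-, rfl, rfl⟩ := h
    rfl
  · rintro ⟨⟨i, j⟩, ⟨p, q⟩, ⟨r, s⟩⟩ h
    simp only [mem_sigma, mem_product, HasAntidiagonal.mem_antidiagonal] at h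
    obtain ⟨-, rfl, rfl⟩ := h
    rfl
  · rintro ⟨⟨i, j⟩, ⟨p, q⟩, ⟨r, s⟩⟩ h
    rfl

lemma lag_zero_zero (k : ℕ) : lag k 0 0 = 1 := by
  rw [lag, sum_range_succ', sum_eq_zero]
  · simp [Real.Gamma_nat_eq_factorial, (Nat.factorial_ne_zero k)]
  · intro i _
    simp

lemma lag_sum_range {γ : ℝ} (hγ : -1 < γ) (m : ℕ) (y : ℝ) :
    lag m (γ + 1) y = ∑ k ∈ range (m + 1), lag k γ y := by
  have h := lag_add hγ (show (-1 : ℝ) < 0 by norm_num) m y 0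
  rw [add_zero, add_zero] at h
  rw [h, Finset.Nat.sum_antidiagonal_eq_sum_range_succ_mk]
  simp [lag_zero_zero]

open scoped Nat in
/-- Even derivatives of the Gaussian are Laguerre polynomials of order `-1/2`. -/
lemma lag_neg_half_mul_gaussian (m : ℕ) (y : ℝ) :
    lag m (-1 / 2) (y ^ 2) * Real.exp (-y ^ 2) =
      (-1) ^ m / ((m.factorial : ℝ) * 4 ^ m) *
        iteratedDeriv (2 * m) (fun s => Real.exp (-s ^ 2)) y := by
  have hg : (fun s : ℝ => Real.exp (-s ^ 2)) =
      fun s => (fun z : ℝ => Real.exp (-(z ^ 2 / 2))) (√2 * s) := by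
    funext s
    simp only [mul_pow]
    rw [Real.sq_sqrt (by norm_num)]
    congr 1; ring
  have hD : iteratedDeriv (2 * m) (fun s => Real.exp (-s ^ 2)) y =
      2 ^ m * (Polynomial.aeval (√2 * y) (Polynomial.hermite (2 * m)) * Real.exp (-y ^ 2)) := by
    have hs : ContDiff ℝ ((2 * m : ℕ)) (fun z : ℝ => Real.exp (-(z ^ 2 / 2))) := by fun_prop
    rw [hg, iteratedDeriv_comp_const_mul hs]
    simp only
    rw [iteratedDeriv_eq_iterate, Polynomial.deriv_gaussian_eq_hermite_mul_gaussian, pow_mul,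
      pow_mul (-1 : ℝ), Real.sq_sqrt (by norm_num), mul_pow, Real.sq_sqrt (by norm_num)]
    norm_num
  have hH : Polynomial.aeval (√2 * y) (Polynomial.hermite (2 * m)) =
      ∑ i ∈ range (m + 1), (-1 : ℝ) ^ (m - i) * ((2 * (m - i) - 1)‼ : ℕ) *
        ((2 * m).choose (2 * i) : ℕ) * (2 * y ^ 2) ^ i := by
    rw [Polynomial.aeval_eq_sum_range, Polynomial.natDegree_hermite]
    have hodd : ∀ n : ℕ, ∀ f : ℕ → ℝ, (∀ i, f (2 * i + 1) = 0) →
        ∑ i ∈ range (2 * n + 1), f i = ∑ i ∈ range (n + 1), f (2 * i) := by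
      intro n f hf
      induction n with
      | zero => simp
      | succ n ih =>
        rw [show 2 * (n + 1) + 1 = 2 * n + 1 + 1 + 1 by ring, sum_range_succ, sum_range_succ, ih,
          sum_range_succ _ (n + 1), hf, show 2 * n + 1 + 1 = 2 * (n + 1) by ring]
        ring
    rw [hodd]
    · refine sum_congr rfl fun i hi => ?_
      have him : i ≤ m := Nat.lt_succ_iff.mp (mem_range.mp hi)
      have h := Polynomial.coeff_hermite_explicit (m - i) (2 * i)
      rw [show 2 * (m - i) + 2 * i = 2 * m by omega] at h
      rw [h, zsmul_eq_mul, pow_mul, mul_pow, Real.sq_sqrt (by norm_num)]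
      push_cast
      ring
    · intro i
      rw [Polynomial.coeff_hermite_of_odd_add ⟨m + i, by ring⟩]
      simp
  have hdf : ∀ n : ℕ, ((2 * n)! : ℝ) = 2 ^ n * n ! * ((2 * n - 1)‼ : ℕ) := by
    intro n
    cases n with
    | zero => simp
    | succ n =>
      rw [show 2 * (n + 1) = 2 * n + 1 + 1 by ring, Nat.factorial_eq_mul_doubleFactorial,
        show 2 * n + 1 + 1 = 2 * (n + 1) by ring, Nat.doubleFactorial_two_mul]
      push_cast
      rw [show 2 * (n + 1) - 1 = 2 * n + 1 by omega]
  rw [hD, hH, lag]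
  simp only [sum_mul, mul_sum]
  refine sum_congr rfl fun i hi => ?_
  have him : i ≤ m := Nat.lt_succ_iff.mp (mem_range.mp hi)
  have hG : ∀ n : ℕ, (n : ℝ) + -1 / 2 + 1 = n + 1 / 2 := fun n => by ring
  rw [hG, hG, Real.Gamma_nat_add_half, Real.Gamma_nat_add_half]
  have hc : ((2 * m).choose (2 * i) : ℝ) * (2 * i)! * (2 * (m - i))! = (2 * m)! := by
    have := Nat.choose_mul_factorial_mul_factorial (show 2 * i ≤ 2 * m by omega)
    rw [show 2 * m - 2 * i = 2 * (m - i) by omega] at this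
    exact_mod_cast this
  rw [hdf, hdf, hdf] at hc
  have p1 : (0 : ℝ) < ((2 * m - 1)‼ : ℕ) := by exact_mod_cast Nat.doubleFactorial_pos _
  have p2 : (0 : ℝ) < ((2 * i - 1)‼ : ℕ) := by exact_mod_cast Nat.doubleFactorial_pos _
  have p3 : (0 : ℝ) < ((2 * (m - i) - 1)‼ : ℕ) := by exact_mod_cast Nat.doubleFactorial_pos _
  have f1 : (0 : ℝ) < (m ! : ℕ) := by exact_mod_cast Nat.factorial_pos _
  have f2 : (0 : ℝ) < (i ! : ℕ) := by exact_mod_cast Nat.factorial_pos _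
  have f3 : (0 : ℝ) < ((m - i)! : ℕ) := by exact_mod_cast Nat.factorial_pos _
  have hpi : (0 : ℝ) < √π := Real.sqrt_pos.mpr Real.pi_pos
  obtain ⟨d, rfl⟩ := Nat.exists_eq_add_of_le him
  rw [Nat.add_sub_cancel_left] at *
  have hsgn : (-1 : ℝ) ^ (i + d) * (-1) ^ d = (-1) ^ i := by
    rw [pow_add, mul_assoc, ← mul_pow]; norm_num
  rw [← hsgn]
  have h4 : (4 : ℝ) ^ (i + d) = 2 ^ (i + d) * 2 ^ (i + d) := by rw [← mul_pow]; norm_num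
  rw [h4]
  field_simp
  generalize ((2 * (i + d) - 1)‼ : ℕ) = a1 at *
  generalize ((2 * i - 1)‼ : ℕ) = a2 at *
  generalize ((2 * d - 1)‼ : ℕ) = a3 at *
  rw [pow_add] at *
  have h2 : (2 : ℝ) ^ i * 2 ^ d ≠ 0 := by positivity
  apply mul_left_cancel₀ h2
  linear_combination (-(y ^ 2) ^ i * 2 ^ i) * hc

lemma integrable_gaussian : Integrable (fun s : ℝ => Real.exp (-s ^ 2)) := by
  simpa using integrable_exp_neg_mul_sq (b := 1) one_pos

lemma integral_gaussian_one : ∫ s : ℝ, Real.exp (-s ^ 2) = √π := by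
  simpa using integral_gaussian 1

/-- Upper tail of the Gaussian integral. -/
noncomputable def gaussTail (z : ℝ) : ℝ := ∫ s in Set.Ioi z, Real.exp (-s ^ 2)

lemma hasDerivAt_gaussTail (z : ℝ) : HasDerivAt gaussTail (-Real.exp (-z ^ 2)) z := by
  have h : gaussTail = fun z => gaussTail 0 - ∫ s in (0 : ℝ)..z, Real.exp (-s ^ 2) := by
    funext w
    rw [gaussTail, gaussTail, ← intervalIntegral.integral_interval_add_Ioi
      (a := 0) (b := w) integrable_gaussian.integrableOn integrable_gaussian.integrableOn]
    ring
  rw [h]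
  have hc : Continuous (fun s : ℝ => Real.exp (-s ^ 2)) := by fun_prop
  exact (intervalIntegral.integral_hasDerivAt_right (hc.intervalIntegrable _ _)
    (hc.stronglyMeasurableAtFilter _ _) hc.continuousAt).const_sub _

lemma tendsto_gaussTail_atTop : Filter.Tendsto gaussTail Filter.atTop (nhds 0) :=
  tendsto_integral_Ioi_zero Filter.tendsto_id

lemma tendsto_gaussTail_atBot : Filter.Tendsto gaussTail Filter.atBot (nhds √π) := by
  have h : gaussTail = fun z => √π - ∫ s in Set.Iic z, Real.exp (-s ^ 2) := by
    funext z
    rw [gaussTail, ← integral_gaussian_one,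
      ← intervalIntegral.integral_Iic_add_Ioi (b := z) integrable_gaussian.integrableOn
        integrable_gaussian.integrableOn]
    ring
  rw [h]
  simpa using (tendsto_integral_Iic_zero (f := fun s : ℝ => Real.exp (-s ^ 2))
    (μ := volume) Filter.tendsto_id).const_sub √π

/-- Subordination formula for the three-dimensional Yukawa kernel. -/
lemma integral_exp_div_sqrt_pow_three {lam r : ℝ} (hlam : 0 < lam) (hr : 0 < r) :
    ∫ t in Set.Ioi (0 : ℝ), Real.exp (-lam ^ 2 * t / 4) * Real.exp (-r ^ 2 / t) / √t ^ 3 =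
      √π / r * Real.exp (-lam * r) := by
  let u : ℝ → ℝ := fun t => r / √t - lam / 2 * √t
  let v : ℝ → ℝ := fun t => r / √t + lam / 2 * √t
  let f : ℝ → ℝ := fun t =>
    (Real.exp (-lam * r) * gaussTail (u t) + Real.exp (lam * r) * gaussTail (v t)) / r
  have hd : ∀ t ∈ Set.Ioi (0 : ℝ), HasDerivAt f
      (Real.exp (-lam ^ 2 * t / 4) * Real.exp (-r ^ 2 / t) / √t ^ 3) t := by
    intro t ht
    have ht' : 0 < t := ht
    have hs : 0 < √t := Real.sqrt_pos.mpr ht'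
    have h1 := Real.hasDerivAt_sqrt ht'.ne'
    have h2 : HasDerivAt (fun t => r / √t) (-(r * (1 / (2 * √t))) / √t ^ 2) t := by
      exact ((hasDerivAt_const t r).div h1 hs.ne').congr_deriv (by ring)
    have hu : HasDerivAt u _ t := h2.sub (h1.const_mul (lam / 2))
    have hv : HasDerivAt v _ t := h2.add (h1.const_mul (lam / 2))
    have h3 := ((((hasDerivAt_gaussTail (u t)).comp t hu).const_mul (Real.exp (-lam * r))).add
      (((hasDerivAt_gaussTail (v t)).comp t hv).const_mul (Real.exp (lam * r)))).div_const r
    refine h3.congr_deriv ?_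
    have hst : t = √t ^ 2 := (Real.sq_sqrt ht'.le).symm
    have e1 : Real.exp (-lam * r) * Real.exp (-u t ^ 2) =
        Real.exp (-lam ^ 2 * t / 4) * Real.exp (-r ^ 2 / t) := by
      rw [← Real.exp_add, ← Real.exp_add]
      congr 1
      simp only [u]
      generalize √t = w at *
      subst hst
      field_simp
      ring
    have e2 : Real.exp (lam * r) * Real.exp (-v t ^ 2) =
        Real.exp (-lam ^ 2 * t / 4) * Real.exp (-r ^ 2 / t) := by
      rw [← Real.exp_add, ← Real.exp_add]
      congr 1
      simp only [v]
      generalize √t = w at *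
      subst hst
      field_simp
      ring
    have alg : ∀ A B P Q d e : ℝ, (A * (-P * d) + B * (-Q * e)) / r =
        (-(A * P) * d - B * Q * e) / r := fun A B P Q d e => by ring
    rw [alg, e1, e2]
    field_simp
    ring
  have hsq0 : Filter.Tendsto (fun t : ℝ => r / √t) (nhdsWithin 0 (Set.Ioi 0)) Filter.atTop := by
    refine Filter.Tendsto.const_mul_atTop hr ?_
    refine tendsto_inv_nhdsGT_zero.comp ?_
    refine tendsto_nhdsWithin_iff.mpr ⟨?_, ?_⟩
    · have := (Real.continuous_sqrt.tendsto 0).mono_left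
        (nhdsWithin_le_nhds (s := Set.Ioi (0 : ℝ)))
      simpa using this
    · filter_upwards [self_mem_nhdsWithin] with t ht using Real.sqrt_pos.mpr ht
  have hs0 : Filter.Tendsto (fun t : ℝ => lam / 2 * √t) (nhdsWithin 0 (Set.Ioi 0)) (nhds 0) := by
    have h : Continuous fun t : ℝ => lam / 2 * √t := by fun_prop
    simpa using (h.tendsto 0).mono_left (nhdsWithin_le_nhds (s := Set.Ioi (0 : ℝ)))
  have hsi : Filter.Tendsto (fun t : ℝ => lam / 2 * √t) Filter.atTop Filter.atTop :=
    Real.tendsto_sqrt_atTop.const_mul_atTop (by positivity)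
  have hri : Filter.Tendsto (fun t : ℝ => r / √t) Filter.atTop (nhds 0) :=
    Real.tendsto_sqrt_atTop.const_div_atTop r
  have hf0 : Filter.Tendsto f (nhdsWithin 0 (Set.Ioi 0)) (nhds 0) := by
    have hu : Filter.Tendsto u (nhdsWithin 0 (Set.Ioi 0)) Filter.atTop := by
      simpa only [u, sub_eq_add_neg] using hsq0.atTop_add hs0.neg
    have hv : Filter.Tendsto v (nhdsWithin 0 (Set.Ioi 0)) Filter.atTop := hsq0.atTop_add hs0
    have := (((tendsto_gaussTail_atTop.comp hu).const_mul (Real.exp (-lam * r))).add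
      ((tendsto_gaussTail_atTop.comp hv).const_mul (Real.exp (lam * r)))).div_const r
    rwa [mul_zero, mul_zero, add_zero, zero_div] at this
  have hfi : Filter.Tendsto f Filter.atTop (nhds (√π / r * Real.exp (-lam * r))) := by
    have hu : Filter.Tendsto u Filter.atTop Filter.atBot := by
      simpa only [u, sub_eq_add_neg, Function.comp_def] using
        hri.add_atBot (Filter.tendsto_neg_atTop_atBot.comp hsi)
    have hv : Filter.Tendsto v Filter.atTop Filter.atTop := hri.add_atTop hsi
    have := (((tendsto_gaussTail_atBot.comp hu).const_mul (Real.exp (-lam * r))).add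
      ((tendsto_gaussTail_atTop.comp hv).const_mul (Real.exp (lam * r)))).div_const r
    refine this.congr' ?_ |>.trans (le_of_eq ?_)
    · exact Filter.Eventually.of_forall fun _ => rfl
    · congr 1; ring
  have hd' : ∀ t ∈ Set.Ioi (0 : ℝ), HasDerivAt (Function.update f 0 0)
      (Real.exp (-lam ^ 2 * t / 4) * Real.exp (-r ^ 2 / t) / √t ^ 3) t := by
    intro t ht
    refine (hd t ht).congr_of_eventuallyEq ?_
    filter_upwards [eventually_ne_nhds (ne_of_gt ht)] with s hs
    exact Function.update_of_ne hs _ _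
  have hc : ContinuousWithinAt (Function.update f 0 0) (Set.Ici 0) 0 := by
    rw [continuousWithinAt_update_same, Set.Ici_sdiff_left]
    exact hf0
  have hfi' : Filter.Tendsto (Function.update f 0 0) Filter.atTop
      (nhds (√π / r * Real.exp (-lam * r))) := by
    refine hfi.congr' ?_
    filter_upwards [Filter.eventually_ne_atTop 0] with s hs
    exact (Function.update_of_ne hs _ _).symm
  rw [integral_Ioi_of_hasDerivAt_of_nonneg hc hd' (fun t _ => by positivity) hfi']
  simp

/-- The unnormalised Gaussian. -/
noncomputable def gauss (s : ℝ) : ℝ := Real.exp (-s ^ 2)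

lemma contDiff_gauss {n : WithTop ℕ∞} : ContDiff ℝ n gauss := by
  unfold gauss; fun_prop

lemma hasDerivAt_gauss (s : ℝ) : HasDerivAt gauss (-2 * s * gauss s) s := by
  have := ((hasDerivAt_pow 2 s).neg).exp
  refine this.congr_deriv ?_
  simp [gauss]; ring

lemma hasDerivAt_iteratedDeriv {f : ℝ → ℝ} (hf : ∀ n : ℕ, ContDiff ℝ n f) (n : ℕ) (x : ℝ) :
    HasDerivAt (iteratedDeriv n f) (iteratedDeriv (n + 1) f x) x := by
  rw [iteratedDeriv_succ]
  exact ((hf (n + 1)).differentiable_iteratedDeriv n (by exact_mod_cast n.lt_succ_self) x).hasDerivAt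

lemma exists_iteratedDeriv_gauss_eq (n : ℕ) :
    ∃ P : Polynomial ℝ, ∀ s, iteratedDeriv n gauss s = P.eval s * gauss s := by
  induction n with
  | zero => exact ⟨1, fun s => by simp⟩
  | succ n ih =>
    obtain ⟨P, hP⟩ := ih
    refine ⟨Polynomial.derivative P - 2 * Polynomial.X * P, fun s => ?_⟩
    rw [iteratedDeriv_succ, show iteratedDeriv n gauss = fun s => P.eval s * gauss s from funext hP]
    refine ((P.hasDerivAt s).mul (hasDerivAt_gauss s)).deriv.trans ?_
    simp
    ring

lemma exists_abs_pow_le (i : ℕ) : ∃ C : ℝ, ∀ s : ℝ, |s ^ i| ≤ C * Real.exp (s ^ 2 / 2) := by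
  refine ⟨1 + 2 ^ i * i.factorial, fun s => ?_⟩
  have h1 : |s ^ i| ≤ 1 + (s ^ 2) ^ i := by
    rw [← abs_of_nonneg (show (0 : ℝ) ≤ (s ^ 2) ^ i by positivity), ← pow_mul, mul_comm 2 i, pow_mul,
      abs_pow (s ^ i) 2]
    nlinarith [sq_nonneg (|s ^ i| - 1), abs_nonneg (s ^ i)]
  have h2 := Real.pow_div_factorial_le_exp (s ^ 2 / 2) (by positivity) i
  rw [div_pow, div_div, div_le_iff₀ (by positivity)] at h2
  have h3 : 1 ≤ Real.exp (s ^ 2 / 2) := Real.one_le_exp (by positivity)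
  linarith

lemma exists_abs_eval_le (P : Polynomial ℝ) :
    ∃ C : ℝ, ∀ s : ℝ, |P.eval s| ≤ C * Real.exp (s ^ 2 / 2) := by
  choose C hC using exists_abs_pow_le
  refine ⟨∑ i ∈ range (P.natDegree + 1), |P.coeff i| * C i, fun s => ?_⟩
  rw [Polynomial.eval_eq_sum_range, sum_mul]
  refine (abs_sum_le_sum_abs _ _).trans (sum_le_sum fun i _ => ?_)
  rw [abs_mul, mul_assoc]
  exact mul_le_mul_of_nonneg_left (hC i s) (abs_nonneg _)

lemma exists_abs_iteratedDeriv_gauss_le (n : ℕ) :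
    ∃ C : ℝ, ∀ s, |iteratedDeriv n gauss s| ≤ C * Real.exp (-(1 / 2) * s ^ 2) := by
  obtain ⟨P, hP⟩ := exists_iteratedDeriv_gauss_eq n
  obtain ⟨C, hC⟩ := exists_abs_eval_le P
  refine ⟨C, fun s => ?_⟩
  have h : Real.exp (-(1 / 2) * s ^ 2) = Real.exp (s ^ 2 / 2) * gauss s := by
    rw [gauss, ← Real.exp_add]; congr 1; ring
  have hg : 0 < gauss s := Real.exp_pos _
  rw [hP, abs_mul, abs_of_pos hg, h, ← mul_assoc]
  exact mul_le_mul_of_nonneg_right (hC s) hg.le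

lemma continuous_iteratedDeriv_gauss (n : ℕ) : Continuous (iteratedDeriv n gauss) :=
  contDiff_gauss.continuous_iteratedDeriv n le_rfl

lemma exists_abs_iteratedDeriv_gauss_le_const (n : ℕ) :
    ∃ C : ℝ, ∀ s, |iteratedDeriv n gauss s| ≤ C := by
  obtain ⟨C, hC⟩ := exists_abs_iteratedDeriv_gauss_le n
  have h0 : 0 ≤ C := by
    have := (abs_nonneg _).trans (hC 0)
    simpa using this
  refine ⟨C, fun s => (hC s).trans ?_⟩
  have : Real.exp (-(1 / 2) * s ^ 2) ≤ 1 := Real.exp_le_one_iff.mpr (by nlinarith [sq_nonneg s])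
  nlinarith

lemma integrable_iteratedDeriv_gauss (n : ℕ) : Integrable (iteratedDeriv n gauss) := by
  obtain ⟨C, hC⟩ := exists_abs_iteratedDeriv_gauss_le n
  refine ((integrable_exp_neg_mul_sq (b := 1 / 2) (by norm_num)).const_mul C).mono'
    (continuous_iteratedDeriv_gauss n).aestronglyMeasurable (ae_of_all _ hC)

lemma tendsto_iteratedDeriv_gauss_atTop (n : ℕ) :
    Filter.Tendsto (iteratedDeriv n gauss) Filter.atTop (nhds 0) := by
  obtain ⟨C, hC⟩ := exists_abs_iteratedDeriv_gauss_le n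
  refine squeeze_zero_norm hC ?_
  rw [show (0 : ℝ) = C * 0 by ring]
  refine Filter.Tendsto.const_mul C (Real.tendsto_exp_atBot.comp ?_)
  exact (Filter.tendsto_pow_atTop two_ne_zero).const_mul_atTop_of_neg (by norm_num)

/-- Scaled Gaussian. -/
noncomputable def gaussScaled (c : ℝ) (z : ℝ) : ℝ := gauss (c * z)

lemma iteratedDeriv_gaussScaled (c : ℝ) (n : ℕ) :
    iteratedDeriv n (gaussScaled c) = fun z => c ^ n * iteratedDeriv n gauss (c * z) :=
  iteratedDeriv_comp_const_mul contDiff_gauss c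

lemma contDiff_gaussScaled (c : ℝ) {n : WithTop ℕ∞} : ContDiff ℝ n (gaussScaled c) :=
  contDiff_gauss.comp (contDiff_const.mul contDiff_id)

lemma exists_abs_iteratedDeriv_gaussScaled_le (c : ℝ) (n : ℕ) :
    ∃ C : ℝ, ∀ s, |iteratedDeriv n (gaussScaled c) s| ≤ C := by
  obtain ⟨C, hC⟩ := exists_abs_iteratedDeriv_gauss_le_const n
  refine ⟨|c ^ n| * C, fun s => ?_⟩
  rw [iteratedDeriv_gaussScaled, abs_mul]
  exact mul_le_mul_of_nonneg_left (hC _) (abs_nonneg _)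

lemma continuous_iteratedDeriv_gaussScaled (c : ℝ) (n : ℕ) :
    Continuous (iteratedDeriv n (gaussScaled c)) :=
  (contDiff_gaussScaled c).continuous_iteratedDeriv n le_rfl

lemma integrable_gaussScaled_mul (c x : ℝ) (m n : ℕ) : Integrable
    (fun y => iteratedDeriv m (gaussScaled c) (x - y) * iteratedDeriv n gauss y) := by
  obtain ⟨C, hC⟩ := exists_abs_iteratedDeriv_gaussScaled_le c m
  refine (integrable_iteratedDeriv_gauss n).bdd_mul (c := C) ?_ (ae_of_all _ fun y => hC (x - y))
  exact ((continuous_iteratedDeriv_gaussScaled c m).comp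
    (continuous_const.sub continuous_id)).aestronglyMeasurable

/-- Gaussian transform over a set of a derivative of the Gaussian. -/
noncomputable def gaussTransform (c : ℝ) (S : Set ℝ) (m n : ℕ) (x : ℝ) : ℝ :=
  ∫ y in S, iteratedDeriv m (gaussScaled c) (x - y) * iteratedDeriv n gauss y

lemma hasDerivAt_gaussTransform (c : ℝ) (S : Set ℝ) (m n : ℕ) (x : ℝ) :
    HasDerivAt (gaussTransform c S m n) (gaussTransform c S (m + 1) n x) x := by
  obtain ⟨C, hC⟩ := exists_abs_iteratedDeriv_gaussScaled_le c (m + 1)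
  refine (hasDerivAt_integral_of_dominated_loc_of_deriv_le (s := Set.univ)
    (bound := fun y => C * |iteratedDeriv n gauss y|)
    (F := fun x y => iteratedDeriv m (gaussScaled c) (x - y) * iteratedDeriv n gauss y)
    (F' := fun x y => iteratedDeriv (m + 1) (gaussScaled c) (x - y) * iteratedDeriv n gauss y)
    Filter.univ_mem ?_ ?_ ?_ ?_ ?_ ?_).2
  · exact Filter.Eventually.of_forall fun x =>
      (integrable_gaussScaled_mul c x m n).restrict.aestronglyMeasurable
  · exact (integrable_gaussScaled_mul c x m n).restrict
  · exact (integrable_gaussScaled_mul c x (m + 1) n).restrict.aestronglyMeasurable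
  · refine ae_of_all _ fun y z _ => ?_
    rw [norm_mul]
    exact mul_le_mul_of_nonneg_right (hC _) (norm_nonneg _)
  · exact ((integrable_iteratedDeriv_gauss n).abs.const_mul C).restrict
  · refine ae_of_all _ fun y z _ => ?_
    exact ((hasDerivAt_iteratedDeriv (fun _ => contDiff_gaussScaled c) m (z - y)).comp_sub_const
      z y).mul_const _

lemma hasDerivAt_gaussScaled_const_sub (c x y : ℝ) (m : ℕ) :
    HasDerivAt (fun y => iteratedDeriv m (gaussScaled c) (x - y))
      (-iteratedDeriv (m + 1) (gaussScaled c) (x - y)) y :=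
  (hasDerivAt_iteratedDeriv (fun _ => contDiff_gaussScaled c) m (x - y)).comp_const_sub x y

lemma gaussTransform_univ_succ (c : ℝ) (n : ℕ) (x : ℝ) :
    gaussTransform c Set.univ 1 n x = gaussTransform c Set.univ 0 (n + 1) x := by
  simp only [gaussTransform, Measure.restrict_univ]
  rw [integral_mul_deriv_eq_deriv_mul_of_integrable
    (fun y _ => hasDerivAt_gaussScaled_const_sub c x y 0)
    (fun y _ => hasDerivAt_iteratedDeriv (fun _ => contDiff_gauss) n y)
    (integrable_gaussScaled_mul c x 0 (n + 1)) ?_ (integrable_gaussScaled_mul c x 0 n),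
    ← integral_neg]
  · simp
  · refine (integrable_gaussScaled_mul c x 1 n).neg.congr (ae_of_all _ fun y => ?_)
    simp

lemma gaussTransform_Ioi_succ (c a : ℝ) (n : ℕ) (x : ℝ) :
    gaussTransform c (Set.Ioi a) 1 n x = gaussTransform c (Set.Ioi a) 0 (n + 1) x +
      gaussScaled c (x - a) * iteratedDeriv n gauss a := by
  simp only [gaussTransform]
  rw [integral_Ioi_mul_deriv_eq_deriv_mul
    (fun y _ => hasDerivAt_gaussScaled_const_sub c x y 0)
    (fun y _ => hasDerivAt_iteratedDeriv (fun _ => contDiff_gauss) n y)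
    (integrable_gaussScaled_mul c x 0 (n + 1)).integrableOn ?_
    (a' := gaussScaled c (x - a) * iteratedDeriv n gauss a) (b' := 0) ?_ ?_]
  · simp only [neg_mul, integral_neg]
    ring
  · refine ((integrable_gaussScaled_mul c x 1 n).neg.congr (ae_of_all _ fun y => ?_)).integrableOn
    simp
  · refine Filter.Tendsto.mono_left ?_ nhdsWithin_le_nhds
    have : Continuous (fun y => iteratedDeriv 0 (gaussScaled c) (x - y) * iteratedDeriv n gauss y) :=
      ((continuous_iteratedDeriv_gaussScaled c 0).comp (continuous_const.sub continuous_id)).mul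
        (continuous_iteratedDeriv_gauss n)
    simpa using! this.tendsto a
  · obtain ⟨C, hC⟩ := exists_abs_iteratedDeriv_gaussScaled_le c 0
    refine squeeze_zero_norm (a := fun y => C * |iteratedDeriv n gauss y|) (fun y => ?_) ?_
    · rw [Pi.mul_apply, norm_mul]
      exact mul_le_mul_of_nonneg_right (hC _) (norm_nonneg _)
    · simpa using (tendsto_iteratedDeriv_gauss_atTop n).abs.const_mul C

lemma iteratedDeriv_gaussTransform_univ (c : ℝ) (n : ℕ) :
    iteratedDeriv n (gaussTransform c Set.univ 0 0) = gaussTransform c Set.univ 0 n := by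
  induction n with
  | zero => simp
  | succ n ih =>
    funext x
    rw [iteratedDeriv_succ, ih, (hasDerivAt_gaussTransform c Set.univ 0 n x).deriv,
      gaussTransform_univ_succ]

lemma iteratedDeriv_gaussTransform_Ioi (c a : ℝ) (n : ℕ) :
    iteratedDeriv n (gaussTransform c (Set.Ioi a) 0 0) = fun x =>
      gaussTransform c (Set.Ioi a) 0 n x + ∑ j ∈ range n,
        iteratedDeriv j (gaussScaled c) (x - a) * iteratedDeriv (n - (j + 1)) gauss a := by
  induction n with
  | zero => simp
  | succ n ih =>
    funext x
    have hs : HasDerivAt (fun x => ∑ j ∈ range n,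
        iteratedDeriv j (gaussScaled c) (x - a) * iteratedDeriv (n - (j + 1)) gauss a)
        (∑ j ∈ range n,
        iteratedDeriv (j + 1) (gaussScaled c) (x - a) * iteratedDeriv (n - (j + 1)) gauss a) x :=
      HasDerivAt.fun_sum fun j _ => ((hasDerivAt_iteratedDeriv
        (fun _ => contDiff_gaussScaled c) j (x - a)).comp_sub_const x a).mul_const _
    rw [iteratedDeriv_succ, ih, ((hasDerivAt_gaussTransform c (Set.Ioi a) 0 n x).fun_add hs).deriv,
      gaussTransform_Ioi_succ, sum_range_succ', iteratedDeriv_zero]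
    simp only [Nat.add_sub_add_right, zero_add, Nat.add_sub_cancel]
    ring

lemma iteratedDeriv_gauss_eq_herm (k : ℕ) (s : ℝ) :
    iteratedDeriv k gauss s = (-1) ^ k * herm k s * gauss s := by
  have h1 : Real.exp (s ^ 2) * gauss s = 1 := by
    rw [gauss, ← Real.exp_add]; simp
  have h2 : ((-1 : ℝ) ^ k) * (-1) ^ k = 1 := by rw [← mul_pow]; simp
  change iteratedDeriv k gauss s =
    (-1) ^ k * ((-1 : ℝ) ^ k * Real.exp (s ^ 2) * iteratedDeriv k gauss s) * gauss s
  linear_combination (-iteratedDeriv k gauss s * ((-1) ^ k * (-1) ^ k)) * h1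
    - iteratedDeriv k gauss s * h2

lemma iteratedDeriv_gauss_neg (k : ℕ) (s : ℝ) :
    iteratedDeriv k gauss (-s) = (-1) ^ k * iteratedDeriv k gauss s := by
  have h := iteratedDeriv_comp_neg k gauss (-s)
  rw [show (fun x => gauss (-x)) = gauss from funext fun x => by simp [gauss], neg_neg] at h
  exact h

lemma deriv_gaussTail : deriv gaussTail = fun z => -gauss z :=
  funext fun z => (hasDerivAt_gaussTail z).deriv

lemma contDiff_gaussTail (n : ℕ) : ContDiff ℝ n gaussTail := by
  cases n with
  | zero => exact contDiff_zero.mpr (Differentiable.continuous (𝕜 := ℝ) fun z =>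
      (hasDerivAt_gaussTail z).differentiableAt)
  | succ n =>
    rw [Nat.cast_succ, contDiff_succ_iff_deriv, deriv_gaussTail]
    exact ⟨fun z => (hasDerivAt_gaussTail z).differentiableAt, by simp, contDiff_gauss.neg⟩

lemma iteratedDeriv_succ_gaussTail (n : ℕ) (z : ℝ) :
    iteratedDeriv (n + 1) gaussTail z = -iteratedDeriv n gauss z := by
  rw [iteratedDeriv_succ', deriv_gaussTail, iteratedDeriv_fun_neg]

lemma integral_Ioi_gauss_comp {k : ℝ} (hk : 0 < k) (s a : ℝ) :
    ∫ y in Set.Ioi a, gauss (k * y - s) = k⁻¹ * gaussTail (k * a - s) := by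
  have hd : ∀ y ∈ Set.Ici a, HasDerivAt (fun y => -k⁻¹ * gaussTail (k * y - s))
      (gauss (k * y - s)) y := by
    intro y _
    have h1 : HasDerivAt (fun y => k * y - s) k y := by
      simpa using ((hasDerivAt_id y).const_mul k).sub_const s
    refine (((hasDerivAt_gaussTail _).comp y h1).const_mul (-k⁻¹)).congr_deriv ?_
    rw [gauss]
    field_simp
  have hl : Filter.Tendsto (fun y => -k⁻¹ * gaussTail (k * y - s)) Filter.atTop (nhds 0) := by
    have h1 : Filter.Tendsto (fun y => k * y - s) Filter.atTop Filter.atTop :=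
      Filter.tendsto_atTop_add_const_right _ _ (Filter.tendsto_id.const_mul_atTop hk)
    simpa using (tendsto_gaussTail_atTop.comp h1).const_mul (-k⁻¹)
  rw [integral_Ioi_of_hasDerivAt_of_nonneg' hd (fun y _ => (Real.exp_pos _).le) hl]
  ring

lemma integral_gauss_comp {k : ℝ} (hk : 0 < k) (s : ℝ) :
    ∫ y, gauss (k * y - s) = k⁻¹ * √π := by
  have h := Measure.integral_comp_mul_left (fun z => gauss (z - s)) k
  rw [h, integral_sub_right_eq_self gauss s, abs_of_pos (inv_pos.mpr hk), smul_eq_mul]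
  congr 1
  exact integral_gaussian_one

section

variable {b d : ℝ}

lemma gaussScaled_mul_gauss (hb : 0 < b) (hd : 0 < d) (h : d ^ 2 = 1 + b ^ 2) (x y : ℝ) :
    gaussScaled b⁻¹ (x - y) * gauss y = gauss (x / d) * gauss (d / b * y - x / (b * d)) := by
  simp only [gaussScaled, gauss]
  rw [← Real.exp_add, ← Real.exp_add]
  congr 1
  field_simp
  have : d ^ 4 = (1 + b ^ 2) ^ 2 := by rw [← h]; ring
  ring_nf
  rw [this, h]
  ring

lemma gaussTransform_Ioi_zero (hb : 0 < b) (hd : 0 < d) (h : d ^ 2 = 1 + b ^ 2) (a x : ℝ) :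
    gaussTransform b⁻¹ (Set.Ioi a) 0 0 x =
      b / d * (gaussTail (d / b * a - x / (b * d)) * gauss (x / d)) := by
  simp only [gaussTransform, iteratedDeriv_zero, gaussScaled_mul_gauss hb hd h]
  rw [integral_const_mul, integral_Ioi_gauss_comp (by positivity), inv_div]
  ring

lemma gaussTransform_univ_zero (hb : 0 < b) (hd : 0 < d) (h : d ^ 2 = 1 + b ^ 2) (x : ℝ) :
    gaussTransform b⁻¹ Set.univ 0 0 x = √π * b / d * gaussScaled d⁻¹ x := by
  simp only [gaussTransform, iteratedDeriv_zero, gaussScaled_mul_gauss hb hd h,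
    Measure.restrict_univ]
  rw [integral_const_mul, integral_gauss_comp (by positivity), inv_div, gaussScaled,
    inv_mul_eq_div]
  ring

lemma gaussTransform_univ_eq (hb : 0 < b) (hd : 0 < d) (h : d ^ 2 = 1 + b ^ 2) (n : ℕ) (x : ℝ) :
    gaussTransform b⁻¹ Set.univ 0 n x =
      √π * b / d ^ (n + 1) * iteratedDeriv n gauss (x / d) := by
  rw [← iteratedDeriv_gaussTransform_univ, show gaussTransform b⁻¹ Set.univ 0 0 = _ from
    funext (gaussTransform_univ_zero hb hd h), iteratedDeriv_const_mul_field,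
    iteratedDeriv_gaussScaled]
  simp only
  rw [inv_mul_eq_div, inv_pow]
  field_simp
  ring

/-- The boundary polynomial produced by a half-line Gaussian transform. -/
noncomputable def boundarySum (b d a x f : ℝ) (n : ℕ) : ℝ :=
  ∑ j ∈ Icc 1 n, ((-1) ^ j / b ^ j) *
    ((n.choose j : ℝ) * herm (n - j) (x / d) * herm (j - 1) f / d ^ (n + 1) -
      herm (j - 1) ((a - x) / b) * herm (n - j) a)

lemma iteratedDeriv_gaussTail_comp (p q : ℝ) (n : ℕ) (x : ℝ) :
    iteratedDeriv n (fun x => gaussTail (p - q * x)) x =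
      (-q) ^ n * iteratedDeriv n gaussTail (p - q * x) := by
  have h := iteratedDeriv_comp_const_mul (n := n) (f := fun z => gaussTail (p + z))
    ((contDiff_gaussTail n).comp (contDiff_const.add contDiff_id)) (-q)
  simp only [neg_mul, ← sub_eq_add_neg, iteratedDeriv_comp_const_add] at h
  rw [h]

lemma gaussTransform_Ioi_eq (hb : 0 < b) (hd : 0 < d) (h : d ^ 2 = 1 + b ^ 2) {n : ℕ}
    (hn : Even n) (a x : ℝ) :
    gaussTransform b⁻¹ (Set.Ioi a) 0 n x =
      b / d ^ (n + 1) * iteratedDeriv n gauss (x / d) *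
        gaussTail (d / b * a - x / (b * d)) +
      b * gauss (x / d) * gauss (d / b * a - x / (b * d)) *
        boundarySum b d a x (d / b * a - x / (b * d)) n := by
  have h0 := congrFun (iteratedDeriv_gaussTransform_Ioi b⁻¹ a n) x
  have h1 : gaussTransform b⁻¹ (Set.Ioi a) 0 0 = fun x =>
      b / d * (gaussTail (d / b * a - (b * d)⁻¹ * x) * gaussScaled d⁻¹ x) := by
    funext x
    rw [gaussTransform_Ioi_zero hb hd h, gaussScaled, inv_mul_eq_div, inv_mul_eq_div]
  have h2 : iteratedDeriv n (gaussTransform b⁻¹ (Set.Ioi a) 0 0) x =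
      b / d * ∑ i ∈ range (n + 1), (n.choose i : ℝ) *
        iteratedDeriv i (fun x => gaussTail (d / b * a - (b * d)⁻¹ * x)) x *
        iteratedDeriv (n - i) (gaussScaled d⁻¹) x := by
    rw [h1, iteratedDeriv_const_mul_field, iteratedDeriv_fun_mul _
      (contDiff_gaussScaled _).contDiffAt]
    exact ((contDiff_gaussTail n).comp (contDiff_const.sub
      (contDiff_const.mul contDiff_id))).contDiffAt
  have hs : boundarySum b d a x (d / b * a - x / (b * d)) n = ∑ i ∈ range n,
      ((-1) ^ (i + 1) / b ^ (i + 1)) *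
    ((n.choose (i + 1) : ℝ) * herm (n - (i + 1)) (x / d) *
      herm i (d / b * a - x / (b * d)) / d ^ (n + 1) -
      herm i ((a - x) / b) * herm (n - (i + 1)) a) := by
    rw [boundarySum, ← Finset.Ico_add_one_right_eq_Icc, sum_Ico_eq_sum_range, Nat.add_sub_cancel]
    simp only [add_comm 1, Nat.add_sub_cancel]
  have hx : (b * d)⁻¹ * x = x / (b * d) := inv_mul_eq_div _ _
  rw [← sub_eq_iff_eq_add.mpr h0, h2, sum_range_succ', hs, mul_add, mul_sum, mul_sum,
    add_sub_right_comm, ← sum_sub_distrib, add_comm]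
  congr 1
  · simp only [iteratedDeriv_zero, iteratedDeriv_gaussScaled, inv_mul_eq_div, inv_pow,
      Nat.choose_zero_right, Nat.cast_one, Nat.sub_zero]
    field_simp
    ring
  · refine sum_congr rfl fun i hi => ?_
    have hg : gauss ((a - x) / b) * gauss a =
        gauss (x / d) * gauss (d / b * a - x / (b * d)) := by
      rw [← gaussScaled_mul_gauss hb hd h, gaussScaled, inv_mul_eq_div]
      simp only [gauss, div_pow, sub_sq_comm a x]
    have hi' : n - (i + 1) + i + 1 = n := by have := mem_range.mp hi; omega
    have hs1 : (-1 : ℝ) ^ (n - (i + 1)) = (-1) ^ (i + 1) := by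
      have : Even (n - (i + 1) + (i + 1)) := by rwa [← add_assoc, hi']
      exact neg_one_pow_congr (Nat.even_add.mp this)
    rw [iteratedDeriv_gaussTail_comp, iteratedDeriv_succ_gaussTail, iteratedDeriv_gaussScaled,
      iteratedDeriv_gaussScaled]
    simp only [hx, inv_mul_eq_div]
    rw [← neg_sub a x, neg_div, iteratedDeriv_gauss_neg]
    simp only [iteratedDeriv_gauss_eq_herm, hs1]
    have hdn : d ^ (n + 1) = d ^ (n - (i + 1)) * d ^ (i + 1) * d := by
      rw [← pow_add, ← pow_succ]
      congr 1
      omega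
    have he : ((-1 : ℝ) ^ i) * (-1) ^ i = 1 := by rw [← mul_pow]; simp
    rw [neg_pow, hdn, pow_succ (-1 : ℝ) i]
    simp only [inv_pow, mul_pow]
    generalize (-1 : ℝ) ^ i = e at he ⊢
    generalize herm (n - (i + 1)) a = u
    generalize gauss ((a - x) / b) = g1 at hg ⊢
    generalize gauss (x / d) = g2 at hg ⊢
    generalize gauss a = g3 at hg ⊢
    generalize gauss (d / b * a - x / (b * d)) = g4 at hg ⊢
    generalize herm i (d / b * a - x / (b * d)) = w1
    generalize herm i ((a - x) / b) = w2
    generalize herm (n - (i + 1)) (x / d) = w3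
    have hd1 : d ^ (n - (i + 1)) ≠ 0 := by positivity
    generalize d ^ (n - (i + 1)) = d1 at hd1 ⊢
    field_simp
    linear_combination (e * (-(b * (n.choose (i + 1) : ℝ) * w1 * g4 * w3 * g2 * b ^ i) -
        -(d * b ^ (i + 1) * d ^ (i + 1) * d1 * w2 * g1 * u * g3))) * he +
      (e * (d * b ^ (i + 1) * d ^ (i + 1) * d1 * w2 * u)) * hg

lemma lag_neg_half_mul_gauss (m : ℕ) (y : ℝ) :
    lag m (-1 / 2) (y ^ 2) * gauss y =
      (-1) ^ m / ((m.factorial : ℝ) * 4 ^ m) * iteratedDeriv (2 * m) gauss y :=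
  lag_neg_half_mul_gaussian m y

lemma integral_gaussScaled_mul_lag (hb : 0 < b) (hd : 0 < d) (h : d ^ 2 = 1 + b ^ 2) (m : ℕ)
    (x : ℝ) :
    ∫ y, gaussScaled b⁻¹ (x - y) * (lag m (-1 / 2) (y ^ 2) * gauss y) =
      √π * b / d ^ (2 * m + 1) * (lag m (-1 / 2) ((x / d) ^ 2) * gauss (x / d)) := by
  have h1 := gaussTransform_univ_eq hb hd h (2 * m) x
  simp only [gaussTransform, iteratedDeriv_zero, Measure.restrict_univ] at h1
  simp only [lag_neg_half_mul_gauss, mul_left_comm (gaussScaled _ _)]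
  rw [integral_const_mul, h1]
  ring

lemma integral_Ioi_gaussScaled_mul_lag (hb : 0 < b) (hd : 0 < d) (h : d ^ 2 = 1 + b ^ 2)
    (m : ℕ) (a x : ℝ) :
    ∫ y in Set.Ioi a, gaussScaled b⁻¹ (x - y) * (lag m (-1 / 2) (y ^ 2) * gauss y) =
      b * gauss (x / d) * (lag m (-1 / 2) ((x / d) ^ 2) / d ^ (2 * m + 1) *
          gaussTail (d / b * a - x / (b * d)) +
        (-1) ^ m / ((m.factorial : ℝ) * 4 ^ m) * gauss (d / b * a - x / (b * d)) *
          boundarySum b d a x (d / b * a - x / (b * d)) (2 * m)) := by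
  have h1 := gaussTransform_Ioi_eq hb hd h (even_two_mul m) a x
  simp only [gaussTransform, iteratedDeriv_zero] at h1
  have h2 := lag_neg_half_mul_gauss m (x / d)
  simp only [lag_neg_half_mul_gauss, mul_left_comm (gaussScaled _ _)]
  rw [integral_const_mul, h1]
  linear_combination
    (-(b / d ^ (2 * m + 1) * gaussTail (d / b * a - x / (b * d)))) * h2

lemma integrable_gaussScaled_mul_lag (c x : ℝ) (m : ℕ) :
    Integrable fun y => gaussScaled c (x - y) * (lag m (-1 / 2) (y ^ 2) * gauss y) := by
  simp only [lag_neg_half_mul_gauss]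
  refine ((integrable_gaussScaled_mul c x 0 (2 * m)).const_mul
    ((-1) ^ m / ((m.factorial : ℝ) * 4 ^ m))).congr (ae_of_all _ fun y => ?_)
  simp only [iteratedDeriv_zero]
  ring

end

section

variable {ι : Type*} [Fintype ι]

lemma integral_euclidean_prod (f : ι → ℝ → ℝ) :
    ∫ y : EuclideanSpace ℝ ι, ∏ i, f i (y i) = ∏ i, ∫ s, f i s := by
  rw [← integral_fintype_prod_volume_eq_prod]
  exact (EuclideanSpace.volume_preserving_symm_measurableEquiv_toLp ι).integral_comp'
    (fun y => ∏ i, f i (y i))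

lemma integrable_euclidean_prod {f : ι → ℝ → ℝ} (hf : ∀ i, Integrable (f i)) :
    Integrable fun y : EuclideanSpace ℝ ι => ∏ i, f i (y i) :=
  ((EuclideanSpace.volume_preserving_symm_measurableEquiv_toLp ι).integrable_comp_emb
    (MeasurableEquiv.measurableEmbedding _)).mpr (Integrable.fintype_prod hf)

end

lemma measurableSet_halfSpace (a : ℝ) :
    MeasurableSet {y : EuclideanSpace ℝ (Fin 3) | a ≤ y 2} :=
  (isClosed_le continuous_const (by fun_prop)).measurableSet

lemma integral_halfSpace_mul (f g h : ℝ → ℝ) (a : ℝ) :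
    ∫ y in {y : EuclideanSpace ℝ (Fin 3) | a ≤ y 2}, f (y 0) * g (y 1) * h (y 2) =
      (∫ s, f s) * (∫ s, g s) * ∫ s in Set.Ioi a, h s := by
  have hi := integral_euclidean_prod ![f, g, (Set.Ici a).indicator h]
  simp only [Fin.prod_univ_three, Matrix.cons_val] at hi
  rw [integral_indicator measurableSet_Ici, integral_Ici_eq_integral_Ioi] at hi
  rw [← hi, ← integral_indicator (measurableSet_halfSpace a)]
  congr 1
  funext y
  by_cases hy : a ≤ y 2 <;> simp [Set.indicator, hy]

lemma integrable_mul_three {f g h : ℝ → ℝ} (hf : Integrable f) (hg : Integrable g)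
    (hh : Integrable h) :
    Integrable fun y : EuclideanSpace ℝ (Fin 3) => f (y 0) * g (y 1) * h (y 2) := by
  have := integrable_euclidean_prod (f := ![f, g, h]) (by
    intro i; fin_cases i <;> simpa)
  simpa only [Fin.prod_univ_three, Matrix.cons_val] using! this

lemma lag_half_eq_sum (k : ℕ) (u v w : ℝ) :
    lag k (1 / 2) (u + v + w) = ∑ p ∈ antidiagonal k, ∑ q ∈ antidiagonal p.1,
      lag q.1 (-1 / 2) u * lag q.2 (-1 / 2) v * lag p.2 (-1 / 2) w := by
  rw [show (1 / 2 : ℝ) = 0 + -1 / 2 + 1 by norm_num, lag_add (by norm_num) (by norm_num)]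
  refine sum_congr rfl fun p _ => ?_
  rw [← sum_mul]
  congr 1
  have := lag_add (α := -1 / 2) (β := -1 / 2) (by norm_num) (by norm_num) p.1 u v
  rwa [show (-1 / 2 + -1 / 2 + 1 : ℝ) = 0 by norm_num] at this

lemma eta_three_eq_sum {M : ℕ} (hM : 1 ≤ M) (y : EuclideanSpace ℝ (Fin 3)) :
    eta 3 M y = Real.pi ^ (-(3 : ℝ) / 2) * ∑ k ∈ range M, ∑ p ∈ antidiagonal k,
      ∑ q ∈ antidiagonal p.1, (lag q.1 (-1 / 2) (y 0 ^ 2) * gauss (y 0)) *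
        (lag q.2 (-1 / 2) (y 1 ^ 2) * gauss (y 1)) *
        (lag p.2 (-1 / 2) (y 2 ^ 2) * gauss (y 2)) := by
  have hn : ‖y‖ ^ 2 = y 0 ^ 2 + y 1 ^ 2 + y 2 ^ 2 := by
    rw [EuclideanSpace.real_norm_sq_eq, Fin.sum_univ_three]
  have hg : Real.exp (-(y 0 ^ 2 + y 1 ^ 2 + y 2 ^ 2)) = gauss (y 0) * gauss (y 1) * gauss (y 2) := by
    simp only [gauss, ← Real.exp_add]
    congr 1
    ring
  have hl := lag_sum_range (γ := 1 / 2) (by norm_num) (M - 1) (y 0 ^ 2 + y 1 ^ 2 + y 2 ^ 2)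
  rw [Nat.sub_add_cancel hM] at hl
  rw [eta, hn, hg, Nat.cast_ofNat, show (3 / 2 : ℝ) = 1 / 2 + 1 by norm_num, hl, mul_assoc, sum_mul]
  congr 1
  refine sum_congr rfl fun k _ => ?_
  rw [lag_half_eq_sum, sum_mul]
  refine sum_congr rfl fun p _ => ?_
  rw [sum_mul]
  refine sum_congr rfl fun q _ => ?_
  ring

section

variable {b d : ℝ}

lemma integral_halfSpace_gaussian_lag (hb : 0 < b) (hd : 0 < d) (h : d ^ 2 = 1 + b ^ 2) (a : ℝ)
    (x : EuclideanSpace ℝ (Fin 3)) (p : ℕ × ℕ) :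
    ∑ q ∈ antidiagonal p.1, ∫ y in {y : EuclideanSpace ℝ (Fin 3) | a ≤ y 2},
      (gaussScaled b⁻¹ (x 0 - y 0) * (lag q.1 (-1 / 2) (y 0 ^ 2) * gauss (y 0))) *
        (gaussScaled b⁻¹ (x 1 - y 1) * (lag q.2 (-1 / 2) (y 1 ^ 2) * gauss (y 1))) *
        (gaussScaled b⁻¹ (x 2 - y 2) * (lag p.2 (-1 / 2) (y 2 ^ 2) * gauss (y 2))) =
    Real.pi * b ^ 3 * (gauss (x 0 / d) * gauss (x 1 / d) * gauss (x 2 / d)) *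
      (lag p.1 0 ((x 0 / d) ^ 2 + (x 1 / d) ^ 2) * lag p.2 (-1 / 2) ((x 2 / d) ^ 2) /
          d ^ (2 * (p.1 + p.2) + 3) * gaussTail (d / b * a - x 2 / (b * d)) +
        gauss (d / b * a - x 2 / (b * d)) * ((-1) ^ p.2 / ((p.2.factorial : ℝ) * 4 ^ p.2) *
          lag p.1 0 ((x 0 / d) ^ 2 + (x 1 / d) ^ 2) / d ^ (2 * p.1 + 2) *
          boundarySum b d a (x 2) (d / b * a - x 2 / (b * d)) (2 * p.2))) := by
  have hl := lag_add (α := -1 / 2) (β := -1 / 2) (by norm_num) (by norm_num) p.1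
    ((x 0 / d) ^ 2) ((x 1 / d) ^ 2)
  rw [show (-1 / 2 + -1 / 2 + 1 : ℝ) = 0 by norm_num] at hl
  rw [hl]
  have hsq : √Real.pi * √Real.pi = Real.pi := Real.mul_self_sqrt Real.pi_pos.le
  simp only [sum_mul, sum_div, mul_sum, ← sum_add_distrib]
  refine sum_congr rfl fun q hq => ?_
  rw [integral_halfSpace_mul
    (fun s => gaussScaled b⁻¹ (x 0 - s) * (lag q.1 (-1 / 2) (s ^ 2) * gauss s))
    (fun s => gaussScaled b⁻¹ (x 1 - s) * (lag q.2 (-1 / 2) (s ^ 2) * gauss s))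
    (fun s => gaussScaled b⁻¹ (x 2 - s) * (lag p.2 (-1 / 2) (s ^ 2) * gauss s)),
    integral_gaussScaled_mul_lag hb hd h, integral_gaussScaled_mul_lag hb hd h,
    integral_Ioi_gaussScaled_mul_lag hb hd h, ← HasAntidiagonal.mem_antidiagonal.mp hq]
  generalize √Real.pi = s at hsq
  rw [← hsq]
  field_simp
  ring

lemma integral_halfSpace_gaussian_eta (hb : 0 < b) (hd : 0 < d) (h : d ^ 2 = 1 + b ^ 2) {M : ℕ}
    (hM : 1 ≤ M) (a : ℝ) (x : EuclideanSpace ℝ (Fin 3)) :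
    ∫ y in {y : EuclideanSpace ℝ (Fin 3) | a ≤ y 2}, Real.exp (-‖x - y‖ ^ 2 / b ^ 2) * eta 3 M y =
    Real.pi ^ (-(1 : ℝ) / 2) * b ^ 3 * Real.exp (-‖x‖ ^ 2 / d ^ 2) *
      (gaussTail (d / b * a - x 2 / (b * d)) *
          ∑ k ∈ range M, lag k (1 / 2) (‖x‖ ^ 2 / d ^ 2) / d ^ (2 * k + 3) +
        gauss (d / b * a - x 2 / (b * d)) * ∑ k ∈ range M, ∑ p ∈ antidiagonal k,
          (-1) ^ p.2 / ((p.2.factorial : ℝ) * 4 ^ p.2) *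
          lag p.1 0 ((x 0 ^ 2 + x 1 ^ 2) / d ^ 2) / d ^ (2 * p.1 + 2) *
          boundarySum b d a (x 2) (d / b * a - x 2 / (b * d)) (2 * p.2)) := by
  have hx : ‖x‖ ^ 2 = x 0 ^ 2 + x 1 ^ 2 + x 2 ^ 2 := by
    rw [EuclideanSpace.real_norm_sq_eq, Fin.sum_univ_three]
  have hG : Real.exp (-‖x‖ ^ 2 / d ^ 2) =
      gauss (x 0 / d) * gauss (x 1 / d) * gauss (x 2 / d) := by
    simp only [gauss, ← Real.exp_add, hx]
    congr 1
    field_simp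
    ring
  have hpt : ∀ y : EuclideanSpace ℝ (Fin 3), Real.exp (-‖x - y‖ ^ 2 / b ^ 2) * eta 3 M y =
      Real.pi ^ (-(3 : ℝ) / 2) * ∑ k ∈ range M, ∑ p ∈ antidiagonal k, ∑ q ∈ antidiagonal p.1,
      (gaussScaled b⁻¹ (x 0 - y 0) * (lag q.1 (-1 / 2) (y 0 ^ 2) * gauss (y 0))) *
        (gaussScaled b⁻¹ (x 1 - y 1) * (lag q.2 (-1 / 2) (y 1 ^ 2) * gauss (y 1))) *
        (gaussScaled b⁻¹ (x 2 - y 2) * (lag p.2 (-1 / 2) (y 2 ^ 2) * gauss (y 2))) := by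
    intro y
    have hE : Real.exp (-‖x - y‖ ^ 2 / b ^ 2) = gaussScaled b⁻¹ (x 0 - y 0) *
        gaussScaled b⁻¹ (x 1 - y 1) * gaussScaled b⁻¹ (x 2 - y 2) := by
      simp only [gaussScaled, gauss, ← Real.exp_add, EuclideanSpace.real_norm_sq_eq,
        Fin.sum_univ_three, PiLp.sub_apply]
      congr 1
      field_simp
      ring
    rw [eta_three_eq_sum hM, hE, mul_left_comm]
    simp only [mul_sum]
    refine sum_congr rfl fun k _ => sum_congr rfl fun p _ => sum_congr rfl fun q _ => ?_
    ring
  have hint : ∀ (p q : ℕ × ℕ), IntegrableOn (fun y : EuclideanSpace ℝ (Fin 3) =>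
      (gaussScaled b⁻¹ (x 0 - y 0) * (lag q.1 (-1 / 2) (y 0 ^ 2) * gauss (y 0))) *
        (gaussScaled b⁻¹ (x 1 - y 1) * (lag q.2 (-1 / 2) (y 1 ^ 2) * gauss (y 1))) *
        (gaussScaled b⁻¹ (x 2 - y 2) * (lag p.2 (-1 / 2) (y 2 ^ 2) * gauss (y 2))))
        {y : EuclideanSpace ℝ (Fin 3) | a ≤ y 2} := fun p q =>
    (integrable_mul_three (integrable_gaussScaled_mul_lag _ _ _)
      (integrable_gaussScaled_mul_lag _ _ _) (integrable_gaussScaled_mul_lag _ _ _)).integrableOn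
  simp only [hpt]
  rw [integral_const_mul, integral_finsetSum _ fun k _ => integrable_finsetSum _ fun p _ =>
    integrable_finsetSum _ fun q _ => hint p q]
  have hpi : Real.pi ^ (-(1 : ℝ) / 2) = Real.pi ^ (-(3 : ℝ) / 2) * Real.pi := by
    rw [← Real.rpow_add_one Real.pi_ne_zero]
    norm_num
  rw [hpi, hG]
  simp only [mul_sum, mul_add, ← sum_add_distrib]
  refine sum_congr rfl fun k _ => ?_
  rw [integral_finsetSum _ fun p _ => integrable_finsetSum _ fun q _ => hint p q]
  simp only [integral_finsetSum _ fun q _ => hint _ q]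
  simp only [integral_halfSpace_gaussian_lag hb hd h]
  have hl : lag k (1 / 2) (‖x‖ ^ 2 / d ^ 2) = ∑ p ∈ antidiagonal k,
      lag p.1 0 ((x 0 / d) ^ 2 + (x 1 / d) ^ 2) * lag p.2 (-1 / 2) ((x 2 / d) ^ 2) := by
    rw [← lag_add (by norm_num) (by norm_num)]
    norm_num
    congr 1
    rw [hx]
    ring
  rw [hl]
  simp only [mul_sum, sum_div, ← sum_add_distrib]
  refine sum_congr rfl fun p hp => ?_
  rw [← HasAntidiagonal.mem_antidiagonal.mp hp, add_div, ← div_pow, ← div_pow]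
  ring

end

lemma gaussTail_eq_erfc (z : ℝ) : gaussTail z = √Real.pi / 2 * erfc z := by
  have : √Real.pi ≠ 0 := (Real.sqrt_pos.mpr Real.pi_pos).ne'
  rw [erfc, gaussTail]
  field_simp

section

variable {t : ℝ}

lemma Fn_eq (ht : 0 < t) (x a : ℝ) :
    Fn t x a = √(1 + t) / √t * a - x / (√t * √(1 + t)) := by
  have hb : 0 < √t := Real.sqrt_pos.mpr ht
  have hd : 0 < √(1 + t) := Real.sqrt_pos.mpr (by linarith)
  have hd2 : √(1 + t) * √(1 + t) = 1 + t := Real.mul_self_sqrt (by linarith)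
  rw [Fn, Real.sqrt_div (by linarith), ← hd2, Real.sqrt_mul_self hd.le]
  field_simp

lemma calP_three_eq (ht : 0 < t) (M : ℕ) (s : ℝ) :
    calP 3 M s t = ∑ k ∈ range M, lag k (1 / 2) (s / √(1 + t) ^ 2) / √(1 + t) ^ (2 * k + 3) := by
  have h1 : 0 < 1 + t := by linarith
  refine sum_congr rfl fun k _ => ?_
  rw [Real.sq_sqrt h1.le, Nat.cast_ofNat, show (3 / 2 - 1 : ℝ) = 1 / 2 by norm_num, mul_comm,
    div_eq_mul_inv (lag _ _ _), Real.sqrt_eq_rpow, ← Real.rpow_mul_natCast h1.le,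
    ← Real.rpow_neg h1.le]
  congr 2
  push_cast
  ring

lemma calQ_three_eq (ht : 0 < t) (M : ℕ) (r x a : ℝ) :
    calQ 3 M r x t a = 2 * ∑ k ∈ range M, ∑ p ∈ antidiagonal k,
      (-1) ^ p.2 / ((p.2.factorial : ℝ) * 4 ^ p.2) *
        lag p.1 0 (r / √(1 + t) ^ 2) / √(1 + t) ^ (2 * p.1 + 2) *
        boundarySum √t √(1 + t) a x (Fn t x a) (2 * p.2) := by
  have h1 : 0 < 1 + t := by linarith
  have hd : 0 < √(1 + t) := Real.sqrt_pos.mpr h1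
  have hd2 : √(1 + t) ^ 2 = 1 + t := Real.sq_sqrt h1.le
  have hpre : (1 + t) ^ (-(((3 : ℕ) : ℝ) - 1) / 2) = (√(1 + t) ^ 2)⁻¹ := by
    rw [hd2, ← Real.rpow_neg_one]
    norm_num
  rw [calQ, hpre, mul_assoc, mul_sum]
  congr 1
  refine sum_congr rfl fun k _ => ?_
  rw [Nat.sum_antidiagonal_eq_sum_range_succ_mk, mul_sum]
  refine sum_congr rfl fun l hl => ?_
  have hlk : l ≤ k := Nat.lt_succ_iff.mp (mem_range.mp hl)
  rw [boundarySum, mul_sum, mul_sum, mul_sum]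
  refine sum_congr rfl fun j _ => ?_
  have ht' : t ^ ((j : ℝ) / 2) = √t ^ j := by
    rw [Real.sqrt_eq_rpow, ← Real.rpow_mul_natCast ht.le]
    congr 1
    ring
  have hk' : (1 + t) ^ ((k : ℝ) + 1 / 2) = √(1 + t) ^ (2 * (k - l) + 1) * √(1 + t) ^ (2 * l) := by
    rw [← pow_add, Real.sqrt_eq_rpow, ← Real.rpow_mul_natCast h1.le]
    congr 1
    push_cast [Nat.cast_sub hlk]
    ring
  have hl' : (1 + t) ^ (l : ℝ) = √(1 + t) ^ (2 * l) := by
    rw [pow_mul, hd2, Real.rpow_natCast]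
  rw [ht', hk', hl', ← hd2, Real.sqrt_sq hd.le, Nat.cast_ofNat,
    show ((3 : ℝ) - 3) / 2 = 0 by norm_num]
  field_simp
  ring

lemma integral_halfSpace_heat_eta (ht : 0 < t) {M : ℕ} (hM : 1 ≤ M) (a : ℝ)
    (x : EuclideanSpace ℝ (Fin 3)) :
    ∫ y in {y : EuclideanSpace ℝ (Fin 3) | a ≤ y 2}, Real.exp (-‖x - y‖ ^ 2 / t) * eta 3 M y =
    √t ^ 3 / 2 * (Real.exp (-‖x‖ ^ 2 / (1 + t)) *
      (erfc (Fn t (x 2) a) * calP 3 M (‖x‖ ^ 2) t +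
        Real.pi ^ (-(1 : ℝ) / 2) * Real.exp (-(Fn t (x 2) a) ^ 2) *
          calQ 3 M ((x 0) ^ 2 + (x 1) ^ 2) (x 2) t a)) := by
  have h1 : 0 < 1 + t := by linarith
  have hb2 : √t ^ 2 = t := Real.sq_sqrt ht.le
  have hd2 : √(1 + t) ^ 2 = 1 + t := Real.sq_sqrt h1.le
  have hpi : Real.pi ^ (-(1 : ℝ) / 2) * √Real.pi = 1 := by
    rw [Real.sqrt_eq_rpow, ← Real.rpow_add Real.pi_pos]
    norm_num
  have hmain := integral_halfSpace_gaussian_eta (Real.sqrt_pos.mpr ht) (Real.sqrt_pos.mpr h1)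
    (by rw [hb2, hd2]) hM a x
  rw [← Fn_eq ht, ← calP_three_eq ht, hb2] at hmain
  rw [hmain, calQ_three_eq ht, gaussTail_eq_erfc, hd2, gauss]
  linear_combination (√t ^ 3 / 2 * Real.exp (-‖x‖ ^ 2 / (1 + t)) *
    erfc (Fn t (x 2) a) * calP 3 M (‖x‖ ^ 2) t) * hpi

end

lemma continuous_eta (n M : ℕ) : Continuous (eta n M) := by
  unfold eta lag
  fun_prop

lemma exists_abs_eta_le (n M : ℕ) : ∃ C : ℝ, ∀ y, |eta n M y| ≤ C := by
  refine ⟨|Real.pi ^ (-(n : ℝ) / 2)| * ∑ i ∈ range (M - 1 + 1),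
    |(-1 : ℝ) ^ i * (Real.Gamma (((M - 1 : ℕ) : ℝ) + n / 2 + 1) /
      (Real.Gamma ((i : ℝ) + n / 2 + 1) * ((M - 1 - i).factorial : ℝ)))|, fun y => ?_⟩
  rw [eta, mul_assoc, abs_mul, lag, sum_mul]
  refine mul_le_mul_of_nonneg_left ((abs_sum_le_sum_abs _ _).trans
    (sum_le_sum fun i _ => ?_)) (abs_nonneg _)
  have h := Real.pow_div_factorial_le_exp (‖y‖ ^ 2) (sq_nonneg _) i
  rw [mul_div_assoc, mul_assoc, abs_mul]
  refine mul_le_of_le_one_right (abs_nonneg _) ?_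
  rw [abs_of_nonneg (by positivity), Real.exp_neg, ← div_eq_mul_inv]
  exact (div_le_one (Real.exp_pos _)).mpr h

lemma exp_neg_norm_sub_sq_div {t : ℝ} (ht : 0 < t) (x y : EuclideanSpace ℝ (Fin 3)) :
    Real.exp (-‖x - y‖ ^ 2 / t) = gaussScaled (√t)⁻¹ (x 0 - y 0) *
      gaussScaled (√t)⁻¹ (x 1 - y 1) * gaussScaled (√t)⁻¹ (x 2 - y 2) := by
  simp only [gaussScaled, gauss, ← Real.exp_add, EuclideanSpace.real_norm_sq_eq,
    Fin.sum_univ_three, PiLp.sub_apply, mul_pow, inv_pow, Real.sq_sqrt ht.le]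
  congr 1
  field_simp
  ring

lemma integrable_gaussScaled_sub {b : ℝ} (hb : 0 < b) (x : ℝ) :
    Integrable fun s => gaussScaled b⁻¹ (x - s) :=
  ((integrable_gaussian.comp_mul_left' (inv_ne_zero hb.ne')).comp_sub_left x)

lemma integral_gaussScaled_sub {b : ℝ} (hb : 0 < b) (x : ℝ) :
    ∫ s, gaussScaled b⁻¹ (x - s) = √Real.pi * b := by
  have h := integral_gauss_comp (inv_pos.mpr hb) 0
  simp only [sub_zero, inv_inv] at h
  rw [integral_sub_left_eq_self (gaussScaled b⁻¹), mul_comm, ← h]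
  rfl

lemma integrable_exp_neg_norm_sub_sq_div {t : ℝ} (ht : 0 < t) (x : EuclideanSpace ℝ (Fin 3)) :
    Integrable fun y => Real.exp (-‖x - y‖ ^ 2 / t) := by
  simp only [exp_neg_norm_sub_sq_div ht]
  have hb := Real.sqrt_pos.mpr ht
  exact integrable_mul_three (integrable_gaussScaled_sub hb _) (integrable_gaussScaled_sub hb _)
    (integrable_gaussScaled_sub hb _)

lemma integral_exp_neg_norm_sub_sq_div {t : ℝ} (ht : 0 < t) (x : EuclideanSpace ℝ (Fin 3)) :
    ∫ y, Real.exp (-‖x - y‖ ^ 2 / t) = √Real.pi ^ 3 * √t ^ 3 := by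
  have h := integral_euclidean_prod fun (i : Fin 3) s => gaussScaled (√t)⁻¹ (x i - s)
  simp only [Fin.prod_univ_three, integral_gaussScaled_sub (Real.sqrt_pos.mpr ht)] at h
  simp only [exp_neg_norm_sub_sq_div ht, h]
  ring

lemma integrable_heatKernel {lam : ℝ} (hlam : 0 < lam) (x : EuclideanSpace ℝ (Fin 3)) :
    Integrable (fun z : EuclideanSpace ℝ (Fin 3) × ℝ =>
      Real.exp (-lam ^ 2 * z.2 / 4) * Real.exp (-‖x - z.1‖ ^ 2 / z.2) / √z.2 ^ 3)
      (volume.prod (volume.restrict (Set.Ioi 0))) := by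
  have hmeas : Measurable fun z : EuclideanSpace ℝ (Fin 3) × ℝ =>
      Real.exp (-lam ^ 2 * z.2 / 4) * Real.exp (-‖x - z.1‖ ^ 2 / z.2) / √z.2 ^ 3 := by
    fun_prop
  rw [integrable_prod_iff' hmeas.aestronglyMeasurable]
  constructor
  · refine ae_restrict_of_forall_mem measurableSet_Ioi fun t ht => ?_
    exact ((integrable_exp_neg_norm_sub_sq_div ht x).const_mul
      (Real.exp (-lam ^ 2 * t / 4))).div_const (√t ^ 3)
  · have hI : IntegrableOn (fun t => √Real.pi ^ 3 * Real.exp (-(lam ^ 2 / 4) * t)) (Set.Ioi 0) :=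
      (exp_neg_integrableOn_Ioi 0 (by positivity)).const_mul _
    refine (integrableOn_congr_fun (fun t ht => ?_) measurableSet_Ioi).mpr hI
    have ht' : 0 < √t := Real.sqrt_pos.mpr ht
    have habs : ∀ y, ‖Real.exp (-lam ^ 2 * t / 4) * Real.exp (-‖x - y‖ ^ 2 / t) / √t ^ 3‖ =
        Real.exp (-lam ^ 2 * t / 4) / √t ^ 3 * Real.exp (-‖x - y‖ ^ 2 / t) := fun y => by
      rw [Real.norm_of_nonneg (by positivity)]
      ring
    simp only [habs]
    rw [integral_const_mul, integral_exp_neg_norm_sub_sq_div ht,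
      show -lam ^ 2 * t / 4 = -(lam ^ 2 / 4) * t by ring]
    field_simp

lemma integrable_heatKernel_mul_eta {lam : ℝ} (hlam : 0 < lam) (M : ℕ)
    (x : EuclideanSpace ℝ (Fin 3)) (S : Set (EuclideanSpace ℝ (Fin 3))) :
    Integrable (Function.uncurry fun (y : EuclideanSpace ℝ (Fin 3)) (t : ℝ) =>
      Real.exp (-lam ^ 2 * t / 4) * Real.exp (-‖x - y‖ ^ 2 / t) / √t ^ 3 * eta 3 M y)
      ((volume.restrict S).prod (volume.restrict (Set.Ioi 0))) := by
  obtain ⟨C, hC⟩ := exists_abs_eta_le 3 M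
  have h := (integrable_heatKernel hlam x).mul_bdd (c := C)
    (((continuous_eta 3 M).comp continuous_fst).aestronglyMeasurable)
    (ae_of_all _ fun z => hC z.1)
  exact h.mono_measure (Measure.prod_mono Measure.restrict_le_self le_rfl)

lemma exp_neg_mul_div_eq_integral {lam r : ℝ} (hlam : 0 < lam) (hr : 0 < r) :
    Real.exp (-lam * r) / (4 * Real.pi * r) = 1 / (4 * Real.pi ^ ((3 : ℝ) / 2)) *
      ∫ t in Set.Ioi (0 : ℝ), Real.exp (-lam ^ 2 * t / 4) * Real.exp (-r ^ 2 / t) / √t ^ 3 := by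
  have hpi : Real.pi ^ ((3 : ℝ) / 2) = Real.pi * √Real.pi := by
    rw [Real.sqrt_eq_rpow, ← Real.rpow_one_add' Real.pi_pos.le (by norm_num)]
    norm_num
  have hs := (Real.sqrt_pos.mpr Real.pi_pos).ne'
  rw [integral_exp_div_sqrt_pow_three hlam hr, hpi]
  generalize √Real.pi = s at hs
  field_simp

/-- half-space potential of `η_{2M}` for the modified Helmholtz
fundamental solution in dimension `n = 3`. -/
theorem stmt0 (M : ℕ) (hM : 1 ≤ M) (lam : ℝ) (hlam : 0 < lam) (a : ℝ)
    (x : EuclideanSpace ℝ (Fin 3)) :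
    (∫ y in {y : EuclideanSpace ℝ (Fin 3) | a ≤ y 2},
        Real.exp (-lam * ‖x - y‖) / (4 * Real.pi * ‖x - y‖) * eta 3 M y)
    = (1 / (8 * Real.pi ^ ((3 : ℝ) / 2))) *
        ∫ t in Set.Ioi (0 : ℝ),
          Real.exp (-lam ^ 2 * t / 4) * Real.exp (-‖x‖ ^ 2 / (1 + t)) *
            (erfc (Fn t (x 2) a) * calP 3 M (‖x‖ ^ 2) t
              + Real.pi ^ (-(1 : ℝ) / 2) * Real.exp (-(Fn t (x 2) a) ^ 2) *
                  calQ 3 M ((x 0) ^ 2 + (x 1) ^ 2) (x 2) t a) := by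
  have hker : ∀ᵐ y ∂(volume.restrict {y : EuclideanSpace ℝ (Fin 3) | a ≤ y 2}),
      Real.exp (-lam * ‖x - y‖) / (4 * Real.pi * ‖x - y‖) * eta 3 M y =
        1 / (4 * Real.pi ^ ((3 : ℝ) / 2)) * ∫ t in Set.Ioi (0 : ℝ),
          Real.exp (-lam ^ 2 * t / 4) * Real.exp (-‖x - y‖ ^ 2 / t) / √t ^ 3 * eta 3 M y := by
    refine ae_restrict_of_ae ?_
    filter_upwards [compl_mem_ae_iff.mpr (measure_singleton x)] with y hy
    rw [exp_neg_mul_div_eq_integral hlam (norm_pos_iff.mpr (sub_ne_zero.mpr (Ne.symm hy))),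
      integral_mul_const, mul_assoc]
  rw [integral_congr_ae hker, integral_const_mul,
    integral_integral_swap (integrable_heatKernel_mul_eta hlam M x _),
    show (1 : ℝ) / (8 * Real.pi ^ ((3 : ℝ) / 2)) =
      1 / (4 * Real.pi ^ ((3 : ℝ) / 2)) * (1 / 2) by ring, mul_assoc, ← integral_const_mul (1 / 2)]
  congr 1
  refine setIntegral_congr_fun measurableSet_Ioi fun t ht => ?_
  have ht' : √t ≠ 0 := (Real.sqrt_pos.mpr ht).ne'
  have hpull : ∀ y, Real.exp (-lam ^ 2 * t / 4) * Real.exp (-‖x - y‖ ^ 2 / t) / √t ^ 3 *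
      eta 3 M y = Real.exp (-lam ^ 2 * t / 4) / √t ^ 3 *
        (Real.exp (-‖x - y‖ ^ 2 / t) * eta 3 M y) := fun y => by ring
  simp only [hpull]
  rw [integral_const_mul, integral_halfSpace_heat_eta ht hM]
  field_simp
end

section
/- Let M ≥ 1, λ > 0, and x ∈ ℝ³. Then the whole-space potential of η_{2M} in dimension n = 3 satisfies ∫_{ℝ³} (e^{−λ|x−y|}/(4π|x−y|)) η_{2M}(y) dy = (1/(4π^{3/2})) ∫₀^∞ e^{−λ²t/4} e^{−|x|²/(1+t)} 𝒫_M(x,t) dt. -/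
open MeasureTheory Real Finset

/-- Coefficient of `y ^ i` in the Laguerre polynomial `lag k γ y`; it vanishes for `k < i`. -/
noncomputable def lagCoeff (k : ℕ) (γ : ℝ) (i : ℕ) : ℝ :=
  if i ≤ k then (-1 : ℝ) ^ i * (Real.Gamma ((k : ℝ) + γ + 1) /
      (Real.Gamma ((i : ℝ) + γ + 1) * ((k - i).factorial : ℝ))) / (i.factorial : ℝ) else 0

lemma lagCoeff_of_lt {k i : ℕ} (h : k < i) (γ : ℝ) : lagCoeff k γ i = 0 :=
  if_neg (not_le.2 h)

lemma lagCoeff_add (γ : ℝ) (i m : ℕ) :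
    lagCoeff (i + m) γ i = (-1 : ℝ) ^ i * (Real.Gamma ((i : ℝ) + m + γ + 1) /
      (Real.Gamma ((i : ℝ) + γ + 1) * (m.factorial : ℝ))) / (i.factorial : ℝ) := by
  simp [lagCoeff]

lemma lag_eq_sum_lagCoeff {k N : ℕ} (h : k ≤ N) (γ y : ℝ) :
    lag k γ y = ∑ i ∈ range (N + 1), lagCoeff k γ i * y ^ i := by
  rw [lag, ← sum_subset (range_mono (Nat.add_le_add_right h 1))]
  · refine sum_congr rfl fun i hi ↦ ?_
    rw [lagCoeff, if_pos (Nat.lt_succ_iff.1 (mem_range.1 hi))]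
    ring
  · intro i _ hi
    rw [lagCoeff_of_lt (by simpa using hi), zero_mul]

lemma lagCoeff_succ_zero {γ : ℝ} (hγ : -1 < γ) (k : ℕ) :
    (k + 1 : ℝ) * lagCoeff (k + 1) γ 0 = (k + γ + 1) * lagCoeff k γ 0 := by
  have hk : (k : ℝ) + γ + 1 ≠ 0 := by
    have := k.cast_nonneg (α := ℝ); linarith
  have h1 : (0 : ℝ) < γ + 1 := by linarith
  have hG := (Real.Gamma_pos_of_pos h1).ne'
  have e1 : Real.Gamma ((k : ℝ) + 1 + γ + 1) = (k + γ + 1) * Real.Gamma (k + γ + 1) := by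
    rw [← Real.Gamma_add_one hk]; ring_nf
  simp only [lagCoeff, Nat.zero_le, if_true, Nat.cast_zero, Nat.sub_zero, Nat.factorial_succ]
  push_cast
  rw [e1, zero_add]
  field_simp

lemma lagCoeff_succ_succ {γ : ℝ} (hγ : -1 < γ) (k i : ℕ) :
    (k + 1 : ℝ) * lagCoeff (k + 1) γ (i + 1) =
      (k + γ + 1 + (i + 1)) * lagCoeff k γ (i + 1) - lagCoeff k γ i := by
  have hi : 0 < (i : ℝ) + γ + 1 := by have := i.cast_nonneg (α := ℝ); linarith
  have hG := (Real.Gamma_pos_of_pos hi).ne'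
  have ei : Real.Gamma ((i : ℝ) + 1 + γ + 1) = (i + γ + 1) * Real.Gamma (i + γ + 1) := by
    rw [← Real.Gamma_add_one hi.ne']; ring_nf
  rcases lt_or_ge k i with h | h
  · simp [lagCoeff_of_lt, h, h.trans (Nat.lt_succ_self i)]
  obtain ⟨m, rfl⟩ := Nat.exists_eq_add_of_le h
  have hk : (0 : ℝ) < (i : ℝ) + m + γ + 1 := by have := m.cast_nonneg (α := ℝ); linarith
  have hGk := (Real.Gamma_pos_of_pos hk).ne'
  have ek : Real.Gamma ((i : ℝ) + 1 + m + γ + 1) =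
      (i + m + γ + 1) * Real.Gamma (i + m + γ + 1) := by
    rw [← Real.Gamma_add_one hk.ne']; ring_nf
  rw [show i + m + 1 = (i + 1) + m by ring, lagCoeff_add, lagCoeff_add]
  rcases m with _ | m
  · rw [lagCoeff_of_lt (by simp)]
    simp only [Nat.cast_zero, add_zero, Nat.factorial_succ] at *
    push_cast
    rw [ei]
    field_simp
    ring
  · rw [show i + (m + 1) = (i + 1) + m by ring, lagCoeff_add]
    push_cast [Nat.factorial_succ] at *
    rw [ek, ei, show (i : ℝ) + 1 + m + γ + 1 = i + (m + 1) + γ + 1 by ring]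
    field_simp
    ring

lemma lagCoeff_param_succ {γ : ℝ} (hγ : -1 < γ) (k i : ℕ) :
    lagCoeff (k + 1) (γ + 1) i = lagCoeff k (γ + 1) i + lagCoeff (k + 1) γ i := by
  have hi : 0 < (i : ℝ) + γ + 1 := by have := i.cast_nonneg (α := ℝ); linarith
  have hG := (Real.Gamma_pos_of_pos hi).ne'
  have ei : Real.Gamma ((i : ℝ) + (γ + 1) + 1) = (i + γ + 1) * Real.Gamma (i + γ + 1) := by
    rw [← Real.Gamma_add_one hi.ne']; ring_nf
  rcases lt_or_ge (k + 1) i with h | h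
  · simp [lagCoeff_of_lt, h, (Nat.lt_succ_self k).trans h]
  rcases h.eq_or_lt with rfl | h
  · rw [lagCoeff_of_lt (Nat.lt_succ_self k), zero_add]
    have := (Real.Gamma_pos_of_pos (show 0 < ((k + 1 : ℕ) : ℝ) + (γ + 1) + 1 by
      linarith)).ne'
    simp only [lagCoeff, le_refl, if_true, Nat.sub_self, Nat.factorial_zero, Nat.cast_one, mul_one,
      div_self hG, div_self this]
  obtain ⟨m, rfl⟩ := Nat.exists_eq_add_of_le (Nat.lt_succ_iff.1 h)
  have hk : (0 : ℝ) < (i : ℝ) + m + γ + 1 + 1 := by have := m.cast_nonneg (α := ℝ); linarith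
  have hGk := (Real.Gamma_pos_of_pos hk).ne'
  have ek : Real.Gamma ((i : ℝ) + (m + 1) + (γ + 1) + 1) =
      (i + m + γ + 1 + 1) * Real.Gamma (i + m + γ + 1 + 1) := by
    rw [← Real.Gamma_add_one hk.ne']; ring_nf
  rw [show i + m + 1 = i + (m + 1) by ring]
  simp only [lagCoeff_add]
  push_cast [Nat.factorial_succ]
  rw [ek, ei, show (i : ℝ) + m + (γ + 1) + 1 = i + m + γ + 1 + 1 by ring,
    show (i : ℝ) + (m + 1) + γ + 1 = i + m + γ + 1 + 1 by ring]
  field_simp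
  ring

lemma lag_param_succ {γ : ℝ} (hγ : -1 < γ) (k : ℕ) (y : ℝ) :
    lag k (γ + 1) y = ∑ j ∈ range (k + 1), lag j γ y := by
  induction k with
  | zero =>
    have h0 := (Real.Gamma_pos_of_pos (show 0 < γ + 1 by linarith)).ne'
    have h1 := (Real.Gamma_pos_of_pos (show 0 < γ + 1 + 1 by linarith)).ne'
    simp [lag, div_self h0, div_self h1]
  | succ k ih =>
    rw [sum_range_succ, ← ih, lag_eq_sum_lagCoeff le_rfl, lag_eq_sum_lagCoeff (Nat.le_succ k),
      lag_eq_sum_lagCoeff le_rfl γ, ← sum_add_distrib]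
    exact sum_congr rfl fun i _ ↦ by rw [lagCoeff_param_succ hγ, add_mul]

lemma hasDerivAt_lag (k : ℕ) (γ y : ℝ) :
    HasDerivAt (lag k γ) (∑ i ∈ range (k + 1), lagCoeff k γ i * (i * y ^ (i - 1))) y := by
  rw [show lag k γ = fun y ↦ ∑ i ∈ range (k + 1), lagCoeff k γ i * y ^ i from
    funext fun y ↦ lag_eq_sum_lagCoeff le_rfl γ y]
  exact HasDerivAt.fun_sum fun i _ ↦ (hasDerivAt_pow i y).const_mul _

lemma continuous_lag (k : ℕ) (γ : ℝ) : Continuous (lag k γ) :=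
  continuous_iff_continuousAt.2 fun y ↦ (hasDerivAt_lag k γ y).continuousAt

lemma lag_succ {γ : ℝ} (hγ : -1 < γ) (k : ℕ) (y : ℝ) :
    (k + 1) * lag (k + 1) γ y = (k + γ + 1 - y) * lag k γ y + y * deriv (lag k γ) y := by
  have hd : y * deriv (lag k γ) y =
      ∑ i ∈ range (k + 1 + 1), lagCoeff k γ i * (i * y ^ i) := by
    rw [(hasDerivAt_lag k γ y).deriv, sum_range_succ _ (k + 1),
      lagCoeff_of_lt (Nat.lt_succ_self k), zero_mul, add_zero, mul_sum]
    refine sum_congr rfl fun i _ ↦ ?_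
    rcases i with _ | i
    · simp
    · rw [Nat.add_sub_cancel, pow_succ]; ring
  have hy : y * lag k γ y = ∑ i ∈ range (k + 1), lagCoeff k γ i * y ^ (i + 1) := by
    rw [lag_eq_sum_lagCoeff le_rfl, mul_sum]
    exact sum_congr rfl fun i _ ↦ by ring
  rw [hd, sub_mul, hy, lag_eq_sum_lagCoeff le_rfl, lag_eq_sum_lagCoeff (Nat.le_succ k),
    sum_range_succ' _ (k + 1), sum_range_succ' _ (k + 1), sum_range_succ' _ (k + 1),
    mul_add, mul_add, mul_sum, mul_sum]
  have h0 := lagCoeff_succ_zero hγ k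
  have hs : ∑ i ∈ range (k + 1), (k + 1 : ℝ) * (lagCoeff (k + 1) γ (i + 1) * y ^ (i + 1)) =
      ∑ i ∈ range (k + 1), (k + γ + 1) * (lagCoeff k γ (i + 1) * y ^ (i + 1)) -
        ∑ i ∈ range (k + 1), lagCoeff k γ i * y ^ (i + 1) +
        ∑ i ∈ range (k + 1), lagCoeff k γ (i + 1) * ((i + 1 : ℕ) * y ^ (i + 1)) := by
    rw [← sum_sub_distrib, ← sum_add_distrib]
    refine sum_congr rfl fun i _ ↦ ?_
    push_cast
    linear_combination y ^ (i + 1) * lagCoeff_succ_succ hγ k i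
  simp only [pow_zero, mul_one, Nat.cast_zero, mul_zero, add_zero]
  linear_combination h0 + hs

/-- Laguerre polynomials grow more slowly than `exp (y / 2)`. -/
lemma exists_abs_lag_mul_exp_le (k : ℕ) (γ : ℝ) :
    ∃ C, ∀ y, 0 ≤ y → |lag k γ y| * exp (-y) ≤ C * exp (-(y / 2)) := by
  refine ⟨∑ i ∈ range (k + 1), |lagCoeff k γ i| * (2 ^ i * i.factorial), fun y hy ↦ ?_⟩
  have h2 : exp (-y) = exp (-(y / 2)) * exp (-(y / 2)) := by rw [← exp_add]; ring_nf
  rw [h2, ← mul_assoc]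
  gcongr
  rw [lag_eq_sum_lagCoeff le_rfl]
  calc _ ≤ (∑ i ∈ range (k + 1), |lagCoeff k γ i| * y ^ i) * exp (-(y / 2)) := by
        gcongr
        refine (abs_sum_le_sum_abs _ _).trans_eq (sum_congr rfl fun i _ ↦ ?_)
        rw [abs_mul, abs_of_nonneg (pow_nonneg hy i)]
    _ ≤ _ := by
        rw [sum_mul]
        refine sum_le_sum fun i _ ↦ ?_
        rw [mul_assoc]
        refine mul_le_mul_of_nonneg_left ?_ (abs_nonneg _)
        have := pow_div_factorial_le_exp (y / 2) (by positivity) i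
        rw [exp_neg, ← div_eq_mul_inv, div_le_iff₀ (exp_pos _)]
        calc y ^ i = 2 ^ i * i.factorial * ((y / 2) ^ i / i.factorial) := by
              rw [div_pow]
              field_simp
          _ ≤ _ := by gcongr

/-- The heat-flow profile of the `k`-th Laguerre function in dimension `n`,
as a function of the shifted time `s` and of `r = |x|²`. -/
noncomputable def lagKernel (n k : ℕ) (s r : ℝ) : ℝ :=
  s ^ (-(k : ℝ) - (n : ℝ) / 2) * lag k ((n : ℝ) / 2 - 1) (r / s) * exp (-(r / s))

lemma hasDerivAt_lagKernel {n : ℕ} (hn : 1 ≤ n) (k : ℕ) {s : ℝ} (hs : 0 < s) (r : ℝ) :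
    HasDerivAt (fun s ↦ lagKernel n k s r) (-((k + 1) * lagKernel n (k + 1) s r)) s := by
  have hγ : -1 < (n : ℝ) / 2 - 1 := by
    have : (1 : ℝ) ≤ n := by exact_mod_cast hn
    linarith
  have hy : HasDerivAt (fun s ↦ r / s) (-(r / s ^ 2)) s := by
    simpa [div_eq_mul_inv] using (hasDerivAt_inv hs.ne').const_mul r
  have hL := ((hasDerivAt_lag k ((n : ℝ) / 2 - 1) (r / s)).differentiableAt.hasDerivAt).comp s hy
  have h := (((hasDerivAt_id s).rpow_const (p := -(k : ℝ) - (n : ℝ) / 2) (Or.inl hs.ne')).mul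
    hL).mul hy.neg.exp
  have hrec := lag_succ hγ k (r / s)
  have hp : s ^ (-(k : ℝ) - (n : ℝ) / 2) = s ^ (-(k : ℝ) - (n : ℝ) / 2 - 1) * s := by
    rw [← rpow_add_one hs.ne']; ring_nf
  have hq : -((k + 1 : ℕ) : ℝ) - (n : ℝ) / 2 = -(k : ℝ) - (n : ℝ) / 2 - 1 := by push_cast; ring
  refine h.congr_deriv ?_
  simp only [lagKernel, id, Function.comp, hq, hp, Pi.mul_apply, Pi.neg_apply]
  have hyy : r / s ^ 2 = r / s / s := by field_simp
  rw [hyy]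
  have hss : s * (r / s / s) = r / s := by field_simp
  linear_combination (-(s ^ (-(k : ℝ) - (n : ℝ) / 2 - 1) * exp (-(r / s)))) * (-hrec) +
    (s ^ (-(k : ℝ) - (n : ℝ) / 2 - 1) * exp (-(r / s)) *
      (lag k ((n : ℝ) / 2 - 1) (r / s) - deriv (lag k ((n : ℝ) / 2 - 1)) (r / s))) * hss

lemma exists_abs_lagKernel_le (n k : ℕ) {s₀ : ℝ} (hs₀ : 0 < s₀) :
    ∃ C, ∀ s ∈ Set.Ioo (s₀ / 2) (2 * s₀), ∀ r, 0 ≤ r →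
      |lagKernel n k s r| ≤ C * exp (-(r / (4 * s₀))) := by
  obtain ⟨C, hC⟩ := exists_abs_lag_mul_exp_le k ((n : ℝ) / 2 - 1)
  have hC0 : 0 ≤ C := by
    have := hC 0 le_rfl
    simp only [neg_zero, exp_zero, mul_one, zero_div] at this
    exact (abs_nonneg _).trans this
  refine ⟨(s₀ / 2) ^ (-(k : ℝ) - (n : ℝ) / 2) * C, fun s hs r hr ↦ ?_⟩
  have hs0 : 0 < s := (by positivity : 0 < s₀ / 2).trans hs.1
  rw [lagKernel, abs_mul, abs_mul, abs_of_pos (rpow_pos_of_pos hs0 _), abs_of_pos (exp_pos _),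
    mul_assoc, mul_assoc]
  refine mul_le_mul ?_ ((hC _ (by positivity)).trans ?_) (by positivity) (by positivity)
  · refine rpow_le_rpow_of_nonpos (by positivity) hs.1.le ?_
    have : (0 : ℝ) ≤ k + n / 2 := by positivity
    linarith
  · refine mul_le_mul_of_nonneg_left (exp_le_exp.2 (neg_le_neg ?_)) hC0
    rw [div_div]
    exact div_le_div_of_nonneg_left hr (by positivity) (by linarith [hs.2])

lemma continuous_lagKernel_norm_sq {E : Type*} [SeminormedAddCommGroup E] (n k : ℕ) (s : ℝ) :
    Continuous fun y : E ↦ lagKernel n k s (‖y‖ ^ 2) := by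
  have := continuous_lag k ((n : ℝ) / 2 - 1)
  unfold lagKernel
  fun_prop

/-- Convolution of two Gaussians on `ℝⁿ`. -/
lemma integral_gaussian_mul_gaussian {n : ℕ} {s t : ℝ} (hs : 0 < s) (ht : 0 < t)
    (x : EuclideanSpace ℝ (Fin n)) :
    ∫ y : EuclideanSpace ℝ (Fin n), exp (-(‖x - y‖ ^ 2 / t)) * exp (-(‖y‖ ^ 2 / s)) =
      (π * t * s / (s + t)) ^ ((n : ℝ) / 2) * exp (-(‖x‖ ^ 2 / (s + t))) := by
  have hb : 0 < (s + t) / (t * s) := by positivity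
  have key : ∀ y : EuclideanSpace ℝ (Fin n),
      exp (-(‖x - y‖ ^ 2 / t)) * exp (-(‖y‖ ^ 2 / s)) =
        exp (-((s + t) / (t * s)) * ‖y - (s / (s + t)) • x‖ ^ 2) *
          exp (-(‖x‖ ^ 2 / (s + t))) := fun y ↦ by
    rw [← exp_add, ← exp_add, norm_sub_sq_real, norm_sub_sq_real, norm_smul, inner_smul_right,
      real_inner_comm, norm_of_nonneg (by positivity)]
    congr 1
    field_simp
    ring
  simp_rw [key]
  rw [integral_mul_const, integral_sub_right_eq_self
    (fun y : EuclideanSpace ℝ (Fin n) ↦ exp (-((s + t) / (t * s)) * ‖y‖ ^ 2)),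
    GaussianFourier.integral_rexp_neg_mul_sq_norm hb, finrank_euclideanSpace_fin]
  congr 2
  field_simp

lemma integrable_gaussian_mul_gaussian {n : ℕ} {s t : ℝ} (hs : 0 < s) (ht : 0 < t)
    (x : EuclideanSpace ℝ (Fin n)) :
    Integrable fun y : EuclideanSpace ℝ (Fin n) ↦
      exp (-(‖x - y‖ ^ 2 / t)) * exp (-(‖y‖ ^ 2 / s)) := by
  by_contra h
  have := integral_gaussian_mul_gaussian hs ht x
  rw [integral_undef h] at this
  have : 0 < (π * t * s / (s + t)) ^ ((n : ℝ) / 2) * exp (-(‖x‖ ^ 2 / (s + t))) := by positivity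
  linarith

lemma integrable_gaussian_mul_lagKernel {n : ℕ} (k : ℕ) {s t : ℝ} (hs : 0 < s) (ht : 0 < t)
    (x : EuclideanSpace ℝ (Fin n)) :
    Integrable fun y : EuclideanSpace ℝ (Fin n) ↦
      exp (-(‖x - y‖ ^ 2 / t)) * lagKernel n k s (‖y‖ ^ 2) := by
  obtain ⟨C, hC⟩ := exists_abs_lagKernel_le n k hs
  have hc := continuous_lagKernel_norm_sq (E := EuclideanSpace ℝ (Fin n)) n k s
  refine ((integrable_gaussian_mul_gaussian (show 0 < 4 * s by positivity) ht x).const_mul C).mono'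
    (by fun_prop) (.of_forall fun y ↦ ?_)
  rw [norm_mul, norm_of_nonneg (exp_pos _).le, mul_left_comm]
  gcongr
  exact hC s ⟨by linarith, by linarith⟩ _ (by positivity)

/-- The heat semigroup translates the time parameter of `lagKernel`. -/
lemma integral_heat_mul_lagKernel {n : ℕ} (hn : 1 ≤ n) (k : ℕ) {s t : ℝ} (hs : 0 < s) (ht : 0 < t)
    (x : EuclideanSpace ℝ (Fin n)) :
    ∫ y : EuclideanSpace ℝ (Fin n), exp (-(‖x - y‖ ^ 2 / t)) * lagKernel n k s (‖y‖ ^ 2) =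
      (π * t) ^ ((n : ℝ) / 2) * lagKernel n k (s + t) (‖x‖ ^ 2) := by
  induction k generalizing s with
  | zero =>
    have h0 : ∀ r s : ℝ, lagKernel n 0 s r = s ^ (-((n : ℝ) / 2)) * exp (-(r / s)) := by
      intro r s
      have : Real.Gamma ((n : ℝ) / 2) ≠ 0 := (Real.Gamma_pos_of_pos (by positivity)).ne'
      simp [lagKernel, lag, this]
    simp_rw [h0, mul_left_comm _ (s ^ (-((n : ℝ) / 2)))]
    rw [integral_const_mul, integral_gaussian_mul_gaussian hs ht, ← mul_assoc, ← mul_assoc]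
    congr 1
    rw [div_rpow (by positivity) (by positivity), mul_rpow (by positivity) hs.le,
      rpow_neg hs.le, rpow_neg (by positivity)]
    field_simp
  | succ k ih =>
    obtain ⟨C, hC⟩ := exists_abs_lagKernel_le n (k + 1) hs
    have hmeas (j : ℕ) (s : ℝ) : Continuous fun y : EuclideanSpace ℝ (Fin n) ↦
        exp (-(‖x - y‖ ^ 2 / t)) * lagKernel n j s (‖y‖ ^ 2) := by
      have := continuous_lagKernel_norm_sq (E := EuclideanSpace ℝ (Fin n)) n j s
      fun_prop
    have hmem : Set.Ioo (s / 2) (2 * s) ∈ nhds s := Ioo_mem_nhds (by linarith) (by linarith)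
    have hderiv := (hasDerivAt_integral_of_dominated_loc_of_deriv_le (μ := volume)
      (F := fun s (y : EuclideanSpace ℝ (Fin n)) ↦
        exp (-(‖x - y‖ ^ 2 / t)) * lagKernel n k s (‖y‖ ^ 2))
      (F' := fun s (y : EuclideanSpace ℝ (Fin n)) ↦
        -(k + 1) * (exp (-(‖x - y‖ ^ 2 / t)) * lagKernel n (k + 1) s (‖y‖ ^ 2)))
      (bound := fun y ↦ (k + 1) * C * (exp (-(‖x - y‖ ^ 2 / t)) * exp (-(‖y‖ ^ 2 / (4 * s)))))
      hmem (.of_forall fun s ↦ (hmeas k s).aestronglyMeasurable)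
      (integrable_gaussian_mul_lagKernel k hs ht x)
      ((hmeas (k + 1) s).const_mul _).aestronglyMeasurable
      (.of_forall fun y s' hs' ↦ by
        rw [norm_mul, norm_mul, norm_neg, norm_of_nonneg (exp_pos _).le,
          norm_of_nonneg (by positivity : (0 : ℝ) ≤ k + 1), mul_assoc (k + 1 : ℝ),
          mul_left_comm C]
        gcongr
        exact hC s' hs' _ (by positivity))
      ((integrable_gaussian_mul_gaussian (by positivity) ht x).const_mul _)
      (.of_forall fun y s' hs' ↦ by
        have := (hasDerivAt_lagKernel hn k (s := s') (by linarith [hs'.1]) (‖y‖ ^ 2)).const_mul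
          (exp (-(‖x - y‖ ^ 2 / t)))
        exact this.congr_deriv (by ring))).2
    have hderiv' := ((hasDerivAt_lagKernel hn k (add_pos hs ht) (‖x‖ ^ 2)).comp_add_const s t
      ).const_mul ((π * t) ^ ((n : ℝ) / 2))
    have heq := hderiv.unique (hderiv'.congr_of_eventuallyEq (by
      filter_upwards [hmem] with s' hs'
      exact ih (by linarith [hs'.1])))
    rw [integral_const_mul] at heq
    have hk : (k + 1 : ℝ) ≠ 0 := by positivity
    apply mul_left_cancel₀ hk
    linear_combination -heq

open Filter Topology in
lemma integral_Ioi_of_hasDerivAt_of_nonneg_of_tendsto {f f' : ℝ → ℝ} {a l m : ℝ}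
    (hderiv : ∀ x ∈ Set.Ioi a, HasDerivAt f (f' x) x) (hpos : ∀ x ∈ Set.Ioi a, 0 ≤ f' x)
    (hl : Tendsto f (𝓝[>] a) (𝓝 l)) (hm : Tendsto f atTop (𝓝 m)) :
    IntegrableOn f' (Set.Ioi a) ∧ ∫ x in Set.Ioi a, f' x = m - l := by
  have hcont : ContinuousWithinAt (Function.update f a l) (Set.Ici a) a := by
    rw [continuousWithinAt_update_same]
    simpa using hl
  have hderiv' : ∀ x ∈ Set.Ioi a, HasDerivAt (Function.update f a l) (f' x) x := fun x hx ↦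
    (hderiv x hx).congr_of_eventuallyEq <| by
      filter_upwards [Ioi_mem_nhds hx] with y hy
      exact Function.update_of_ne (ne_of_gt hy) _ _
  have hm' : Tendsto (Function.update f a l) atTop (𝓝 m) := hm.congr' <| by
    filter_upwards [Ioi_mem_atTop a] with y hy
    exact (Function.update_of_ne (ne_of_gt hy) _ _).symm
  refine ⟨integrableOn_Ioi_deriv_of_nonneg hcont hderiv' hpos hm', ?_⟩
  simpa using integral_Ioi_of_hasDerivAt_of_nonneg hcont hderiv' hpos hm'

open Filter Topology in
/-- `∫₀^∞ t^{-3/2} e^{-p²t - q²/t} dt = (√π / q) e^{-2pq}`. -/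
lemma integral_rpow_mul_exp_neg_add_inv {p q : ℝ} (hp : 0 < p) (hq : 0 < q) :
    ∫ t in Set.Ioi (0 : ℝ), t ^ (-(3 / 2) : ℝ) * exp (-(p ^ 2 * t + q ^ 2 / t)) =
      √π / q * exp (-(2 * p * q)) := by
  set g : ℝ → ℝ := fun w ↦ ∫ s in (0 : ℝ)..w, exp (-s ^ 2) with hg
  have hgd (w : ℝ) : HasDerivAt g (exp (-w ^ 2)) w :=
    ((by fun_prop : Continuous fun s : ℝ ↦ exp (-s ^ 2)).integral_hasStrictDerivAt 0 w).hasDerivAt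
  have hint : Integrable fun s : ℝ ↦ exp (-s ^ 2) := by
    simpa using integrable_exp_neg_mul_sq one_pos
  have hgtop : Tendsto g atTop (𝓝 (√π / 2)) := by
    have := intervalIntegral_tendsto_integral_Ioi 0 hint.integrableOn tendsto_id
    have h2 := integral_gaussian_Ioi 1
    simp only [neg_mul, one_mul, div_one] at h2
    rwa [h2] at this
  have hgodd (w : ℝ) : g (-w) = -g w := by
    have := intervalIntegral.integral_comp_neg (a := 0) (b := w) (fun s : ℝ ↦ exp (-s ^ 2))
    simp only [neg_sq, neg_zero] at this
    simp only [hg, this]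
    rw [intervalIntegral.integral_symm]
  have hgbot : Tendsto g atBot (𝓝 (-(√π / 2))) := by
    have := (hgtop.comp tendsto_neg_atBot_atTop).neg
    refine this.congr fun w ↦ ?_
    simp [hgodd]
  have hsq0 : Tendsto (fun t : ℝ ↦ √t) (𝓝[>] 0) (𝓝[>] 0) := by
    refine tendsto_nhdsWithin_iff.2 ⟨?_, ?_⟩
    · simpa using (continuous_sqrt.tendsto 0).mono_left nhdsWithin_le_nhds
    · filter_upwards [self_mem_nhdsWithin] with t ht using sqrt_pos.2 ht
  have hq0 : Tendsto (fun t : ℝ ↦ q / √t) (𝓝[>] 0) atTop := by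
    simpa [div_eq_mul_inv] using (tendsto_inv_nhdsGT_zero.comp hsq0).const_mul_atTop hq
  have hp0 : Tendsto (fun t : ℝ ↦ p * √t) (𝓝[>] 0) (𝓝 0) := by
    simpa using (hsq0.mono_right nhdsWithin_le_nhds).const_mul p
  have hqi : Tendsto (fun t : ℝ ↦ q / √t) atTop (𝓝 0) :=
    tendsto_const_nhds.div_atTop tendsto_sqrt_atTop
  have hpi : Tendsto (fun t : ℝ ↦ p * √t) atTop atTop :=
    tendsto_sqrt_atTop.const_mul_atTop hp
  have hderiv : ∀ t ∈ Set.Ioi (0 : ℝ), HasDerivAt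
      (fun t ↦ -(1 / q) * (exp (2 * p * q) * g (q / √t + p * √t) +
        exp (-(2 * p * q)) * g (q / √t - p * √t)))
      (t ^ (-(3 / 2) : ℝ) * exp (-(p ^ 2 * t + q ^ 2 / t))) t := by
    intro t ht
    have ht : 0 < t := ht
    have hst : 0 < √t := sqrt_pos.2 ht
    have h1 := hasDerivAt_sqrt ht.ne'
    have hA : HasDerivAt (fun t ↦ q / √t) (-(q * (1 / (2 * √t))) / √t ^ 2) t := by
      refine ((hasDerivAt_const t q).div h1 hst.ne').congr_deriv ?_
      ring
    have hB := h1.const_mul p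
    have h := ((((hgd _).comp t (hA.add hB)).const_mul (exp (2 * p * q))).add
      (((hgd _).comp t (hA.sub hB)).const_mul (exp (-(2 * p * q))))).const_mul (-(1 / q))
    refine h.congr_deriv ?_
    have e1 : exp (2 * p * q) * exp (-(q / √t + p * √t) ^ 2) =
        exp (-(p ^ 2 * t + q ^ 2 / t)) := by
      rw [← exp_add]
      congr 1
      nth_rewrite 3 4 [← sq_sqrt ht.le]
      field_simp
      ring
    have e2 : exp (-(2 * p * q)) * exp (-(q / √t - p * √t) ^ 2) =
        exp (-(p ^ 2 * t + q ^ 2 / t)) := by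
      rw [← exp_add]
      congr 1
      nth_rewrite 3 4 [← sq_sqrt ht.le]
      field_simp
      ring
    have e3 : t ^ (-(3 / 2) : ℝ) = 1 / (√t * √t ^ 2) := by
      rw [sq_sqrt ht.le, sqrt_eq_rpow, ← rpow_add_one ht.ne', rpow_neg ht.le, one_div]
      norm_num
    simp only [Pi.add_apply, Pi.sub_apply]
    rw [← mul_assoc (exp (2 * p * q)), ← mul_assoc (exp (-(2 * p * q))), e1, e2, e3]
    field_simp
    ring
  have h := (integral_Ioi_of_hasDerivAt_of_nonneg_of_tendsto hderiv
    (fun t ht ↦ mul_nonneg (rpow_nonneg (le_of_lt ht) _) (exp_pos _).le)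
    ((((hgtop.comp (hq0.atTop_add hp0)).const_mul _).add
      ((hgtop.comp (by simpa [sub_eq_add_neg] using hq0.atTop_add hp0.neg)).const_mul _)).const_mul _)
    ((((hgtop.comp (hqi.add_atTop hpi)).const_mul _).add
      ((hgbot.comp (by
        simpa [sub_eq_add_neg] using hqi.add_atBot (tendsto_neg_atTop_atBot.comp hpi))).const_mul
          _)).const_mul _)).2
  rw [h]
  field_simp
  ring

/-- The Yukawa kernel as a superposition of heat kernels. -/
lemma integral_heat_eq_yukawa {lam z : ℝ} (hlam : 0 < lam) (hz : 0 < z) :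
    ∫ t in Set.Ioi (0 : ℝ),
        1 / 4 * (exp (-lam ^ 2 * t / 4) * (π * t) ^ (-(3 / 2) : ℝ) * exp (-(z ^ 2 / t))) =
      exp (-lam * z) / (4 * π * z) := by
  have h := integral_rpow_mul_exp_neg_add_inv (p := lam / 2) (by positivity) hz
  calc _ = ∫ t in Set.Ioi (0 : ℝ), 1 / 4 * π ^ (-(3 / 2) : ℝ) *
        (t ^ (-(3 / 2) : ℝ) * exp (-((lam / 2) ^ 2 * t + z ^ 2 / t))) := by
        refine setIntegral_congr_fun measurableSet_Ioi fun t ht ↦ ?_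
        have ht : 0 < t := ht
        rw [mul_rpow pi_pos.le ht.le, neg_add, exp_add,
          show -((lam / 2) ^ 2 * t) = -lam ^ 2 * t / 4 by ring]
        ring
    _ = _ := by
        have hpi : π ^ (-(3 / 2) : ℝ) = 1 / (√π * π) := by
          rw [sqrt_eq_rpow, ← rpow_add_one pi_pos.ne', rpow_neg pi_pos.le, one_div]
          norm_num
        rw [integral_const_mul, h, hpi, show -(2 * (lam / 2) * z) = -lam * z by ring]
        field_simp

lemma eta_eq_sum_lagKernel (n : ℕ) (hn : 1 ≤ n) {M : ℕ} (hM : 1 ≤ M)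
    (y : EuclideanSpace ℝ (Fin n)) :
    eta n M y = π ^ (-(n : ℝ) / 2) * ∑ k ∈ range M, lagKernel n k 1 (‖y‖ ^ 2) := by
  obtain ⟨m, rfl⟩ := Nat.exists_eq_add_of_le' hM
  have hγ : -1 < (n : ℝ) / 2 - 1 := by
    have : (1 : ℝ) ≤ n := by exact_mod_cast hn
    linarith
  have := lag_param_succ hγ m (‖y‖ ^ 2)
  rw [sub_add_cancel] at this
  simp [eta, lagKernel, this, ← sum_mul, mul_assoc]

lemma calP_mul_exp_eq_sum_lagKernel (n M : ℕ) (r t : ℝ) :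
    exp (-r / (1 + t)) * calP n M r t = ∑ k ∈ range M, lagKernel n k (1 + t) r := by
  rw [calP, mul_sum]
  exact sum_congr rfl fun k _ ↦ by rw [lagKernel, neg_div]; ring

lemma integrable_heat_mul_eta {lam : ℝ} (hlam : 0 < lam) {M : ℕ} (hM : 1 ≤ M)
    (x : EuclideanSpace ℝ (Fin 3)) :
    Integrable (Function.uncurry fun (t : ℝ) (y : EuclideanSpace ℝ (Fin 3)) ↦
      1 / 4 * (exp (-lam ^ 2 * t / 4) * (π * t) ^ (-(3 / 2) : ℝ) * exp (-(‖x - y‖ ^ 2 / t))) *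
        eta 3 M y) ((volume.restrict (Set.Ioi 0)).prod volume) := by
  choose C hC using fun k ↦ exists_abs_lagKernel_le 3 k one_pos
  have hbound (y : EuclideanSpace ℝ (Fin 3)) : |eta 3 M y| ≤
      π ^ (-(3 : ℝ) / 2) * (∑ k ∈ range M, C k) * exp (-(‖y‖ ^ 2 / 4)) := by
    rw [eta_eq_sum_lagKernel 3 (by norm_num) hM, abs_mul, abs_of_pos (by positivity), mul_assoc,
      sum_mul]
    push_cast
    gcongr
    refine (abs_sum_le_sum_abs _ _).trans (sum_le_sum fun k _ ↦ ?_)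
    simpa using hC k 1 (by norm_num) (‖y‖ ^ 2) (by positivity)
  have heta : Continuous (eta 3 M) := by
    have := continuous_lag (M - 1) (((3 : ℕ) : ℝ) / 2)
    unfold eta
    fun_prop
  have hgauss : Integrable (Function.uncurry fun (t : ℝ) (y : EuclideanSpace ℝ (Fin 3)) ↦
      exp (-lam ^ 2 * t / 4) * (π * t) ^ (-(3 / 2) : ℝ) *
        (exp (-(‖x - y‖ ^ 2 / t)) * exp (-(‖y‖ ^ 2 / 4))))
      ((volume.restrict (Set.Ioi 0)).prod volume) := by
    have hmeas : AEStronglyMeasurable (Function.uncurry fun (t : ℝ) (y : EuclideanSpace ℝ (Fin 3)) ↦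
        exp (-lam ^ 2 * t / 4) * (π * t) ^ (-(3 / 2) : ℝ) *
          (exp (-(‖x - y‖ ^ 2 / t)) * exp (-(‖y‖ ^ 2 / 4))))
        ((volume.restrict (Set.Ioi 0)).prod volume) :=
      Measurable.aestronglyMeasurable (by unfold Function.uncurry; fun_prop)
    rw [integrable_prod_iff hmeas]
    refine ⟨(ae_restrict_iff' measurableSet_Ioi).2 (.of_forall fun t ht ↦
      (integrable_gaussian_mul_gaussian four_pos ht x).const_mul
        (exp (-lam ^ 2 * t / 4) * (π * t) ^ (-(3 / 2) : ℝ))), ?_⟩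
    have hexp : IntegrableOn (fun t : ℝ ↦ exp (-(lam ^ 2 / 4) * t)) (Set.Ioi 0) :=
      integrableOn_exp_mul_Ioi (neg_lt_zero.2 (by positivity)) 0
    refine hexp.mono' hmeas.norm.integral_prod_right'
      ((ae_restrict_iff' measurableSet_Ioi).2 (.of_forall fun t (ht : 0 < t) ↦ ?_))
    have hval : ∫ y : EuclideanSpace ℝ (Fin 3), ‖exp (-lam ^ 2 * t / 4) *
        (π * t) ^ (-(3 / 2) : ℝ) * (exp (-(‖x - y‖ ^ 2 / t)) * exp (-(‖y‖ ^ 2 / 4)))‖ =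
        exp (-(lam ^ 2 / 4) * t) *
          ((4 / (4 + t)) ^ (3 / 2 : ℝ) * exp (-(‖x‖ ^ 2 / (4 + t)))) := by
      have hnorm : ∀ y : EuclideanSpace ℝ (Fin 3), ‖exp (-lam ^ 2 * t / 4) *
          (π * t) ^ (-(3 / 2) : ℝ) * (exp (-(‖x - y‖ ^ 2 / t)) * exp (-(‖y‖ ^ 2 / 4)))‖ =
          exp (-lam ^ 2 * t / 4) *
          (π * t) ^ (-(3 / 2) : ℝ) * (exp (-(‖x - y‖ ^ 2 / t)) * exp (-(‖y‖ ^ 2 / 4))) :=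
        fun y ↦ norm_of_nonneg (by positivity)
      simp_rw [hnorm]
      rw [integral_const_mul, integral_gaussian_mul_gaussian four_pos ht,
        mul_div_assoc (π * t), mul_rpow (x := π * t) (by positivity) (by positivity),
        rpow_neg (x := π * t) (by positivity),
        show -lam ^ 2 * t / 4 = -(lam ^ 2 / 4) * t by ring]
      push_cast
      field_simp
    simp only [Function.uncurry_apply_pair]
    rw [hval, norm_of_nonneg (by positivity)]
    refine mul_le_of_le_one_right (exp_pos _).le (mul_le_one₀ ?_ (exp_pos _).le ?_)
    · exact rpow_le_one (by positivity) ((div_le_one (by positivity)).2 (by linarith)) (by norm_num)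
    · exact exp_le_one_iff.2 (neg_nonpos.2 (by positivity))
  refine (hgauss.norm.const_mul
    (1 / 4 * (π ^ (-(3 : ℝ) / 2) * ∑ k ∈ range M, C k))).mono'
    (Measurable.aestronglyMeasurable (by
      have := heta.measurable
      unfold Function.uncurry; fun_prop)) (.of_forall fun ⟨t, y⟩ ↦ ?_)
  simp only [Function.uncurry_apply_pair, norm_mul, norm_of_nonneg (exp_pos _).le]
  rw [norm_of_nonneg (by norm_num : (0 : ℝ) ≤ 1 / 4)]
  calc _ ≤ 1 / 4 * (exp (-lam ^ 2 * t / 4) * ‖(π * t) ^ (-(3 / 2) : ℝ)‖ *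
        exp (-(‖x - y‖ ^ 2 / t))) *
        (π ^ (-(3 : ℝ) / 2) * (∑ k ∈ range M, C k) * exp (-(‖y‖ ^ 2 / 4))) := by
        gcongr
        exact hbound y
    _ = _ := by ring

/-- whole-space potential of `η_{2M}` in dimension `n = 3`. -/
theorem stmt3 (M : ℕ) (hM : 1 ≤ M) (lam : ℝ) (hlam : 0 < lam)
    (x : EuclideanSpace ℝ (Fin 3)) :
    (∫ y : EuclideanSpace ℝ (Fin 3),
        Real.exp (-lam * ‖x - y‖) / (4 * Real.pi * ‖x - y‖) * eta 3 M y)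
    = (1 / (4 * Real.pi ^ ((3 : ℝ) / 2))) *
        ∫ t in Set.Ioi (0 : ℝ),
          Real.exp (-lam ^ 2 * t / 4) * Real.exp (-‖x‖ ^ 2 / (1 + t)) *
            calP 3 M (‖x‖ ^ 2) t := by
  have hyukawa : ∀ᵐ y : EuclideanSpace ℝ (Fin 3),
      exp (-lam * ‖x - y‖) / (4 * π * ‖x - y‖) * eta 3 M y =
        ∫ t in Set.Ioi (0 : ℝ), 1 / 4 * (exp (-lam ^ 2 * t / 4) * (π * t) ^ (-(3 / 2) : ℝ) *
          exp (-(‖x - y‖ ^ 2 / t))) * eta 3 M y := by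
    filter_upwards [compl_mem_ae_iff.2 (measure_singleton x)] with y hy
    have hxy : 0 < ‖x - y‖ := norm_pos_iff.2 (sub_ne_zero.2 (Ne.symm hy))
    rw [integral_mul_const, integral_heat_eq_yukawa hlam hxy]
  rw [integral_congr_ae hyukawa, ← integral_integral_swap (integrable_heat_mul_eta hlam hM x),
    ← integral_const_mul]
  refine setIntegral_congr_fun measurableSet_Ioi fun t (ht : 0 < t) ↦ ?_
  beta_reduce
  rw [mul_assoc (exp (-lam ^ 2 * t / 4)), calP_mul_exp_eq_sum_lagKernel]
  calc _ = ∫ y : EuclideanSpace ℝ (Fin 3),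
        1 / 4 * exp (-lam ^ 2 * t / 4) * (π * t) ^ (-(3 / 2) : ℝ) * π ^ (-(3 : ℝ) / 2) *
          ∑ k ∈ range M, exp (-(‖x - y‖ ^ 2 / t)) * lagKernel 3 k 1 (‖y‖ ^ 2) := by
        congr 1 with y
        rw [eta_eq_sum_lagKernel 3 (by norm_num) hM, ← mul_sum]
        push_cast
        ring
    _ = _ := by
        rw [integral_const_mul, integral_finsetSum _ fun k _ ↦
          integrable_gaussian_mul_lagKernel k one_pos ht x]
        simp_rw [integral_heat_mul_lagKernel (n := 3) (by norm_num) _ one_pos ht x]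
        rw [← mul_sum, rpow_neg (by positivity), neg_div, rpow_neg pi_pos.le]
        push_cast
        field_simp
end

section
/- For all t > 0 and all x, p ∈ ℝ, one has ∫_p^∞ e^{−(x−y)²/t} e^{−y²} dy = (√π/2) √(t/(1+t)) e^{−x²/(1+t)} erfc(F(t,x,p)). -/
open MeasureTheory Real

theorem setIntegral_comp_sub_right_Ioi {E : Type*} [NormedAddCommGroup E] [NormedSpace ℝ E]
    (g : ℝ → E) (a d : ℝ) :
    ∫ y in Set.Ioi a, g (y - d) = ∫ y in Set.Ioi (a - d), g y := by
  have h := (measurePreserving_sub_right volume d).setIntegral_preimage_emb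
    (measurableEmbedding_subRight d) g (Set.Ioi (a - d))
  simpa using h

/-- explicit formula for `φ₀(x,t,p)`. -/
theorem stmt7 (t : ℝ) (ht : 0 < t) (x p : ℝ) :
    (∫ y in Set.Ioi p, Real.exp (-(x - y) ^ 2 / t) * Real.exp (-y ^ 2))
    = (Real.sqrt Real.pi / 2) * Real.sqrt (t / (1 + t)) * Real.exp (-x ^ 2 / (1 + t)) *
        erfc (Fn t x p) := by
  have h1t : 0 < 1 + t := by positivity
  have hc : 0 < √((1 + t) / t) := by positivity
  have hinv : √(t / (1 + t)) = (√((1 + t) / t))⁻¹ := by rw [← Real.sqrt_inv, inv_div]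
  have hpi : √π ≠ 0 := by positivity
  have complete_square (y : ℝ) : rexp (-(x - y) ^ 2 / t) * rexp (-y ^ 2)
      = rexp (-x ^ 2 / (1 + t)) * rexp (-(√((1 + t) / t) * (y - x / (1 + t))) ^ 2) := by
    rw [← Real.exp_add, ← Real.exp_add, mul_pow, Real.sq_sqrt (by positivity)]
    congr 1
    field_simp
    ring
  simp_rw [complete_square]
  rw [integral_const_mul,
    setIntegral_comp_sub_right_Ioi (fun y ↦ rexp (-(√((1 + t) / t) * y) ^ 2)),
    integral_comp_mul_left_Ioi (fun y ↦ rexp (-y ^ 2)) _ hc, hinv, erfc, Fn, smul_eq_mul]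
  field_simp
end
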